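/- arXiv:2010.16289 — 2 statements merged into one kernel-verified Lean document; each statement's English description precedes it below -/
import Mathlib

section
/- There is an absolute constant c > 0 such that the following holds. In the G(n,M) Erdős–Rényi model, let f(ω) = Σ_{i<j<k} ω_ij ω_jk ω_ik be the number of triangles. Then for every t ≥ 0, P(|f − E f| ≥ t) ≤ 2 exp(− c · min( t² / (n³ + p² n³ + p⁴ n⁴), t / (n^{1/2} + p n), t^{2/3} )). -/
open Finset Real
open scoped Classical

noncomputable section

/-- The multislice `Ω_κ ⊆ 𝒳^N`: vectors with values in `{x ℓ}` where the value `x ℓ`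
appears exactly `κ ℓ` times. -/
def multislice (L N : ℕ) (κ : Fin L → ℕ) (x : Fin L → ℝ) : Finset (Fin N → ℝ) :=
  (Fintype.piFinset fun _ : Fin N => Finset.image x Finset.univ).filter
    (fun ω => ∀ ℓ : Fin L, (Finset.univ.filter fun i => ω i = x ℓ).card = κ ℓ)

/-- Expectation with respect to the uniform distribution on a finite set. -/
def uexpect {α : Type*} (Ω : Finset α) (f : α → ℝ) : ℝ := (∑ ω ∈ Ω, f ω) / Ω.card

/-- Probability of an event with respect to the uniform distribution on a finite set. -/
def uprob {α : Type*} (Ω : Finset α) (p : α → Prop) : ℝ :=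
  ((Ω.filter p).card : ℝ) / Ω.card

/-- The `G(n,M)` Erdős–Rényi model: symmetric `{0,1}`-valued edge configurations
`ω = (ω_ij)` on `n` vertices with exactly `M` edges, equipped with the uniform measure. -/
def erdosRenyiGnM (n M : ℕ) : Finset (Fin n → Fin n → ℝ) :=
  (Fintype.piFinset fun _ : Fin n =>
      Fintype.piFinset fun _ : Fin n => ({0, 1} : Finset ℝ)).filter
    (fun ω => (∀ i j, ω i j = ω j i) ∧
      ((Finset.univ : Finset (Fin n × Fin n)).filter
        fun q => q.1 < q.2 ∧ ω q.1 q.2 = 1).card = M)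

/-- The number of triangles `∑_{i<j<k} ω_ij ω_jk ω_ik`. -/
def triangleCount (n : ℕ) (ω : Fin n → Fin n → ℝ) : ℝ :=
  ∑ q ∈ (Finset.univ : Finset (Fin n × Fin n × Fin n)).filter
      (fun q => q.1 < q.2.1 ∧ q.2.1 < q.2.2),
    ω q.1 q.2.1 * ω q.2.1 q.2.2 * ω q.1 q.2.2

/-- The weight of the outcome `b` under the Bernoulli distribution with parameter `p`. -/
def bernoulliWeight (p : ℝ) (b : Bool) : ℝ := if b then p else 1 - p

/-- Expectation under the product of the Bernoulli distributions with parameters `p i`. -/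
def bernoulliExpect {ι : Type*} [Fintype ι] [DecidableEq ι] (p : ι → ℝ)
    (F : (ι → Bool) → ℝ) : ℝ :=
  ∑ ω : ι → Bool, (∏ i, bernoulliWeight (p i) (ω i)) * F ω

/-- The indicator of the `i`-th coordinate. -/
def coordInd {ι : Type*} (i : ι) (ω : ι → Bool) : ℝ := if ω i then 1 else 0

/-- The centred `i`-th coordinate. -/
def coordCentred {ι : Type*} (p : ι → ℝ) (i : ι) (ω : ι → Bool) : ℝ := coordInd i ω - p i

/-- `F` does not depend on the coordinates in the range of `e`. -/
def FreeOf {ι J : Type*} [DecidableEq ι] (e : J → ι) (F : (ι → Bool) → ℝ) : Prop :=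
  ∀ j b ω, F (Function.update ω (e j) b) = F ω

theorem bernoulliWeight_nonneg {p : ℝ} (hp : p ∈ Set.Icc (0 : ℝ) 1) (b : Bool) :
    0 ≤ bernoulliWeight p b := by
  unfold bernoulliWeight
  split_ifs <;> linarith [hp.1, hp.2]

section Expectation

variable {ι : Type*} [Fintype ι] [DecidableEq ι] {p : ι → ℝ}

theorem bernoulliExpect_mono (hp : ∀ i, p i ∈ Set.Icc (0 : ℝ) 1) {F G : (ι → Bool) → ℝ}
    (h : ∀ ω, F ω ≤ G ω) : bernoulliExpect p F ≤ bernoulliExpect p G :=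
  Finset.sum_le_sum fun ω _ => mul_le_mul_of_nonneg_left (h ω)
    (Finset.prod_nonneg fun i _ => bernoulliWeight_nonneg (hp i) _)

theorem bernoulliExpect_add (p : ι → ℝ) (F G : (ι → Bool) → ℝ) :
    bernoulliExpect p (fun ω => F ω + G ω) = bernoulliExpect p F + bernoulliExpect p G := by
  simp [bernoulliExpect, mul_add, Finset.sum_add_distrib]

theorem bernoulliExpect_sum {J : Type*} (p : ι → ℝ) (s : Finset J)
    (F : J → (ι → Bool) → ℝ) :
    bernoulliExpect p (fun ω => ∑ j ∈ s, F j ω) = ∑ j ∈ s, bernoulliExpect p (F j) := by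
  simp only [bernoulliExpect, Finset.mul_sum]
  exact Finset.sum_comm

theorem bernoulliExpect_const_mul (p : ι → ℝ) (c : ℝ) (F : (ι → Bool) → ℝ) :
    bernoulliExpect p (fun ω => c * F ω) = c * bernoulliExpect p F := by
  simp only [bernoulliExpect, Finset.mul_sum]
  exact Finset.sum_congr rfl fun _ _ => by ring

theorem bernoulliExpect_const (p : ι → ℝ) (c : ℝ) :
    bernoulliExpect p (fun _ => c) = c := by
  have h : ∑ ω : ι → Bool, ∏ i, bernoulliWeight (p i) (ω i) = 1 := by
    rw [← Fintype.prod_sum (fun i b => bernoulliWeight (p i) b)]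
    simp [bernoulliWeight]
  rw [bernoulliExpect, ← Finset.sum_mul, h, one_mul]

theorem sum_bool_fun_eq (i : ι) (g : (ι → Bool) → ℝ) :
    ∑ ω, g ω = ∑ ω : ι → Bool,
      (g (Function.update ω i true) + g (Function.update ω i false)) / 2 := by
  have key : ∀ b : Bool, ∀ r : {j // j ≠ i} → Bool, ∀ b' : Bool,
      Function.update ((Equiv.funSplitAt i Bool).symm (b, r)) i b' =
        (Equiv.funSplitAt i Bool).symm (b', r) := by
    intro b r b'
    ext j
    by_cases hj : j = i
    · subst hj; simp [Equiv.funSplitAt, Equiv.piSplitAt]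
    · simp [Equiv.funSplitAt, Equiv.piSplitAt, hj]
  rw [← (Equiv.funSplitAt i Bool).symm.sum_comp g,
    ← (Equiv.funSplitAt i Bool).symm.sum_comp (fun ω : ι → Bool =>
      (g (Function.update ω i true) + g (Function.update ω i false)) / 2)]
  simp only [Fintype.sum_prod_type, Fintype.sum_bool, key]
  rw [← Finset.sum_add_distrib, ← Finset.sum_add_distrib]
  exact Finset.sum_congr rfl fun _ _ => by ring

/-- Averaging over one coordinate. -/
theorem bernoulliExpect_split (p : ι → ℝ) (i : ι) (F : (ι → Bool) → ℝ) :
    bernoulliExpect p F = bernoulliExpect p (fun ω =>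
      p i * F (Function.update ω i true) + (1 - p i) * F (Function.update ω i false)) := by
  have hprod : ∀ (ω : ι → Bool) b,
      ∏ j, bernoulliWeight (p j) (Function.update ω i b j) =
        bernoulliWeight (p i) b * ∏ j ∈ univ.erase i, bernoulliWeight (p j) (ω j) := by
    intro ω b
    rw [← Finset.mul_prod_erase univ _ (mem_univ i)]
    congr 1
    · simp
    · refine Finset.prod_congr rfl fun j hj => ?_
      rw [Function.update_of_ne (Finset.ne_of_mem_erase hj)]
  unfold bernoulliExpect
  rw [sum_bool_fun_eq i, sum_bool_fun_eq i (fun ω => _ * (_ + _))]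
  refine Finset.sum_congr rfl fun ω _ => ?_
  simp only [hprod, Function.update_idem]
  simp only [bernoulliWeight, if_true, Bool.false_eq_true, if_false]
  ring

/-- Discrete integration by parts. -/
theorem bernoulliExpect_centred_mul (p : ι → ℝ) (i : ι) (G : (ι → Bool) → ℝ) :
    bernoulliExpect p (fun ω => coordCentred p i ω * G ω) =
      bernoulliExpect p (fun ω => p i * (1 - p i) *
        (G (Function.update ω i true) - G (Function.update ω i false))) := by
  rw [bernoulliExpect_split p i]
  congr 1
  ext ω
  simp [coordCentred, coordInd]
  ring

theorem bernoulliExpect_centred_mul_le (hp : ∀ i, p i ∈ Set.Icc (0 : ℝ) 1) (i : ι)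
    (G H : (ι → Bool) → ℝ) (hH : ∀ ω, 0 ≤ H ω)
    (hGH : ∀ ω, G (Function.update ω i true) - G (Function.update ω i false) ≤
      H (Function.update ω i true) + H (Function.update ω i false)) :
    bernoulliExpect p (fun ω => coordCentred p i ω * G ω) ≤ bernoulliExpect p H := by
  rw [bernoulliExpect_centred_mul, bernoulliExpect_split p i H]
  refine bernoulliExpect_mono hp fun ω => ?_
  have h0 := (hp i).1
  have h1 := (hp i).2
  have ht := hH (Function.update ω i true)
  have hf := hH (Function.update ω i false)
  have h2 : 0 ≤ p i * (1 - p i) := mul_nonneg h0 (by linarith)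
  nlinarith [mul_le_mul_of_nonneg_left (hGH ω) h2, mul_nonneg (mul_nonneg h0 h0) ht,
    mul_nonneg (mul_nonneg (sub_nonneg.2 h1) (sub_nonneg.2 h1)) hf]

end Expectation

theorem abs_pow_sub_pow_le_add (x y : ℝ) (k : ℕ) :
    |x ^ k - y ^ k| ≤ k * |x - y| * (|x| ^ (k - 1) + |y| ^ (k - 1)) := by
  have h := abs_pow_sub_pow_le x y k
  have hm : max |x| |y| ^ (k - 1) ≤ |x| ^ (k - 1) + |y| ^ (k - 1) := by
    rcases max_choice |x| |y| with h | h <;> rw [h]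
    · exact le_add_of_nonneg_right (by positivity)
    · exact le_add_of_nonneg_left (by positivity)
  calc _ ≤ _ := h
    _ = k * |x - y| * max |x| |y| ^ (k - 1) := by ring
    _ ≤ _ := by gcongr

theorem coordCentred_update {ι : Type*} [DecidableEq ι] (p : ι → ℝ) (i i' : ι) (b : Bool)
    (ω : ι → Bool) : coordCentred p i (Function.update ω i' b) =
      if i = i' then (if b then 1 else 0) - p i else coordCentred p i ω := by
  by_cases h : i = i'
  · subst h; simp [coordCentred, coordInd]
  · simp [coordCentred, coordInd, h]

theorem sum_centred_update_sub {ι J : Type*} [DecidableEq ι] [Fintype J] {e : J → ι}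
    (p : ι → ℝ) (he : Function.Injective e)
    (a : J → (ι → Bool) → ℝ) (ha : ∀ j, FreeOf e (a j)) (j : J) (ω : ι → Bool) :
    (∑ j', a j' (Function.update ω (e j) true) *
        coordCentred p (e j') (Function.update ω (e j) true)) -
      (∑ j', a j' (Function.update ω (e j) false) *
        coordCentred p (e j') (Function.update ω (e j) false)) = a j ω := by
  rw [← Finset.sum_sub_distrib]
  have : ∀ j', a j' (Function.update ω (e j) true) *
        coordCentred p (e j') (Function.update ω (e j) true) -
      a j' (Function.update ω (e j) false) *
        coordCentred p (e j') (Function.update ω (e j) false) = if j' = j then a j ω else 0 := by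
    intro j'
    rw [ha j', ha j', coordCentred_update, coordCentred_update]
    by_cases h : j' = j
    · subst h; simp; ring
    · simp [he.ne h, h]
  simp [this]

section Moments

variable {ι J : Type*} [Fintype ι] [DecidableEq ι] [Fintype J] {p : ι → ℝ} {e : J → ι}

/-- Moments of linear forms with coefficients that do not depend on the variables involved. -/
theorem bernoulliExpect_linear_pow_le (hp : ∀ i, p i ∈ Set.Icc (0 : ℝ) 1)
    (he : Function.Injective e) (a : J → (ι → Bool) → ℝ) (ha : ∀ j, FreeOf e (a j)) (m : ℕ) :
    ∀ g : (ι → Bool) → ℝ, (∀ ω, 0 ≤ g ω) → FreeOf e g →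
      bernoulliExpect p (fun ω => g ω * (∑ j, a j ω * coordCentred p (e j) ω) ^ (2 * m)) ≤
        bernoulliExpect p (fun ω => g ω * (2 * m * ∑ j, a j ω ^ 2) ^ m) := by
  induction m with
  | zero => intro g _ _; simp
  | succ m ih =>
    intro g hg hgf
    set L : (ι → Bool) → ℝ := fun ω => ∑ j, a j ω * coordCentred p (e j) ω with hL
    have hA : FreeOf e (fun ω => ∑ j, a j ω ^ 2) := fun j b ω =>
      Finset.sum_congr rfl fun j' _ => by rw [ha j']
    have h1 : bernoulliExpect p (fun ω => g ω * L ω ^ (2 * (m + 1))) =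
        ∑ j, bernoulliExpect p (fun ω => coordCentred p (e j) ω *
          (g ω * a j ω * L ω ^ (2 * m + 1))) := by
      rw [← bernoulliExpect_sum]
      congr 1
      ext ω
      rw [show 2 * (m + 1) = (2 * m + 1) + 1 by ring, pow_succ]
      nth_rewrite 2 [hL]
      rw [Finset.mul_sum, Finset.mul_sum]
      exact Finset.sum_congr rfl fun j _ => by ring
    have h2 : ∀ j, bernoulliExpect p (fun ω => coordCentred p (e j) ω *
          (g ω * a j ω * L ω ^ (2 * m + 1))) ≤
        bernoulliExpect p (fun ω => g ω * a j ω ^ 2 * (2 * m + 1) * L ω ^ (2 * m)) := by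
      intro j
      refine bernoulliExpect_centred_mul_le hp (e j) _ _ (fun ω => ?_) (fun ω => ?_)
      · have := hg ω
        have : 0 ≤ L ω ^ (2 * m) := by rw [pow_mul]; positivity
        positivity
      · rw [hgf, hgf, ha, ha]
        set L1 := L (Function.update ω (e j) true)
        set L0 := L (Function.update ω (e j) false)
        have hd : L1 - L0 = a j ω := sum_centred_update_sub p he a ha j ω
        have hpow := abs_pow_sub_pow_le_add L1 L0 (2 * m + 1)
        rw [hd] at hpow
        simp only [Nat.add_sub_cancel, (even_two_mul m).pow_abs] at hpow
        push_cast at hpow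
        have h3 : a j ω * (L1 ^ (2 * m + 1) - L0 ^ (2 * m + 1)) ≤
            a j ω ^ 2 * (2 * m + 1) * (L1 ^ (2 * m) + L0 ^ (2 * m)) := by
          calc _ ≤ |a j ω * (L1 ^ (2 * m + 1) - L0 ^ (2 * m + 1))| := le_abs_self _
            _ = |a j ω| * |L1 ^ (2 * m + 1) - L0 ^ (2 * m + 1)| := abs_mul _ _
            _ ≤ |a j ω| * ((2 * m + 1) * |a j ω| * (L1 ^ (2 * m) + L0 ^ (2 * m))) := by gcongr
            _ = |a j ω| ^ 2 * (2 * m + 1) * (L1 ^ (2 * m) + L0 ^ (2 * m)) := by ring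
            _ = _ := by rw [sq_abs]
        have h4 := mul_le_mul_of_nonneg_left h3 (hg ω)
        linarith
    rw [h1]
    calc _ ≤ ∑ j, bernoulliExpect p
          (fun ω => g ω * a j ω ^ 2 * (2 * m + 1) * L ω ^ (2 * m)) :=
          Finset.sum_le_sum fun j _ => h2 j
      _ = bernoulliExpect p
          (fun ω => (g ω * ((2 * m + 1) * ∑ j, a j ω ^ 2)) * L ω ^ (2 * m)) := by
          rw [← bernoulliExpect_sum]
          congr 1
          ext ω
          simp only [Finset.mul_sum, Finset.sum_mul]
          exact Finset.sum_congr rfl fun j _ => by ring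
      _ ≤ _ := ih _ (fun ω => mul_nonneg (hg ω) (by positivity))
          (fun j b ω => by
            have := hA j b ω
            simp only at this
            rw [hgf, this])
      _ ≤ _ := by
          refine bernoulliExpect_mono hp fun ω => ?_
          have hs : 0 ≤ ∑ j, a j ω ^ 2 := Finset.sum_nonneg fun j _ => sq_nonneg _
          rw [mul_assoc, pow_succ' _ m]
          refine mul_le_mul_of_nonneg_left ?_ (hg ω)
          push_cast
          gcongr <;> linarith

/-- One step of the moment recursion for the squared length of a random linear image. -/
theorem bernoulliExpect_quadratic_pow_succ_le {K : Type*} [Fintype K]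
    (hp : ∀ i, p i ∈ Set.Icc (0 : ℝ) 1) (he : Function.Injective e)
    (A : K → J → (ι → Bool) → ℝ) (hA : ∀ k j, FreeOf e (A k j)) (b : (ι → Bool) → ℝ)
    (hb : ∀ ω (w : K → ℝ), ∑ j, (∑ k, A k j ω * w k) ^ 2 ≤ b ω * ∑ k, w k ^ 2) (m : ℕ)
    (g : (ι → Bool) → ℝ) (hg : ∀ ω, 0 ≤ g ω) (hgf : FreeOf e g) :
    bernoulliExpect p (fun ω =>
        g ω * (∑ k, (∑ j, A k j ω * coordCentred p (e j) ω) ^ 2) ^ (m + 1)) ≤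
      bernoulliExpect p (fun ω =>
        (g ω * (∑ k, ∑ j, A k j ω ^ 2 + 4 * m * b ω)) *
          (∑ k, (∑ j, A k j ω * coordCentred p (e j) ω) ^ 2) ^ m +
        (g ω * (m * b ω * ∑ k, ∑ j, A k j ω ^ 2)) *
          (∑ k, (∑ j, A k j ω * coordCentred p (e j) ω) ^ 2) ^ (m - 1)) := by
  set L : K → (ι → Bool) → ℝ := fun k ω => ∑ j, A k j ω * coordCentred p (e j) ω with hL
  set Q : (ι → Bool) → ℝ := fun ω => ∑ k, L k ω ^ 2 with hQ
  set T : (ι → Bool) → ℝ := fun ω => ∑ k, ∑ j, A k j ω ^ 2 with hT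
  set c : J → (ι → Bool) → ℝ := fun j ω => ∑ k, A k j ω * L k ω with hc
  set B : J → (ι → Bool) → ℝ := fun j ω => ∑ k, A k j ω ^ 2 with hB
  have hQ0 : ∀ ω, 0 ≤ Q ω := fun ω => Finset.sum_nonneg fun k _ => sq_nonneg _
  have hB0 : ∀ j ω, 0 ≤ B j ω := fun j ω => Finset.sum_nonneg fun k _ => sq_nonneg _
  have hTB : ∀ ω, T ω = ∑ j, B j ω := fun ω => Finset.sum_comm
  have hLd : ∀ k j ω, L k (Function.update ω (e j) true) - L k (Function.update ω (e j) false) =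
      A k j ω := fun k j ω => sum_centred_update_sub p he (A k) (hA k) j ω
  have h1 : bernoulliExpect p (fun ω => g ω * Q ω ^ (m + 1)) =
      ∑ j, bernoulliExpect p (fun ω => coordCentred p (e j) ω * (g ω * c j ω * Q ω ^ m)) := by
    rw [← bernoulliExpect_sum]
    congr 1
    ext ω
    have : Q ω = ∑ j, coordCentred p (e j) ω * c j ω := by
      simp only [hQ, hc, Finset.mul_sum]
      rw [Finset.sum_comm]
      refine Finset.sum_congr rfl fun k _ => ?_
      rw [sq]
      nth_rewrite 1 [hL]
      rw [Finset.sum_mul]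
      exact Finset.sum_congr rfl fun j _ => by ring
    rw [pow_succ]
    nth_rewrite 2 [this]
    rw [Finset.mul_sum, Finset.mul_sum]
    exact Finset.sum_congr rfl fun j _ => by ring
  have h2 : ∀ j, bernoulliExpect p (fun ω => coordCentred p (e j) ω *
        (g ω * c j ω * Q ω ^ m)) ≤
      bernoulliExpect p (fun ω => g ω * (B j ω * Q ω ^ m +
        m * (4 * c j ω ^ 2 + B j ω ^ 2) * Q ω ^ (m - 1))) := by
    intro j
    refine bernoulliExpect_centred_mul_le hp (e j) _ _ (fun ω => ?_) (fun ω => ?_)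
    · have := hg ω
      have := hQ0 ω
      have := hB0 j ω
      positivity
    · have hBf : ∀ b, B j (Function.update ω (e j) b) = B j ω := fun b =>
        Finset.sum_congr rfl fun k _ => by rw [hA k j]
      have hcd : c j (Function.update ω (e j) true) - c j (Function.update ω (e j) false) =
          B j ω := by
        simp only [hc, hB, ← Finset.sum_sub_distrib]
        refine Finset.sum_congr rfl fun k _ => ?_
        rw [hA k j, hA k j, ← mul_sub, hLd, sq]
      have hQd : Q (Function.update ω (e j) true) - Q (Function.update ω (e j) false) =
          c j (Function.update ω (e j) true) + c j (Function.update ω (e j) false) := by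
        simp only [hQ, hc, ← Finset.sum_sub_distrib, ← Finset.sum_add_distrib]
        refine Finset.sum_congr rfl fun k _ => ?_
        rw [hA k j, hA k j, ← hLd k j ω]
        ring
      have hQ1 := hQ0 (Function.update ω (e j) true)
      have hQ2 := hQ0 (Function.update ω (e j) false)
      rw [hgf, hgf, hBf, hBf]
      have hB1 := hB0 j ω
      have hg1 := hg ω
      generalize Q (Function.update ω (e j) true) = Q1 at *
      generalize Q (Function.update ω (e j) false) = Q2 at *
      generalize c j (Function.update ω (e j) true) = c1 at *
      generalize c j (Function.update ω (e j) false) = c2 at *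
      have hpow := abs_pow_sub_pow_le_add Q1 Q2 m
      rw [hQd, abs_of_nonneg hQ1, abs_of_nonneg hQ2] at hpow
      have hP1 : 0 ≤ Q1 ^ (m - 1) := by positivity
      have hP2 : 0 ≤ Q2 ^ (m - 1) := by positivity
      have hR1 : 0 ≤ Q1 ^ m := by positivity
      have hR2 : 0 ≤ Q2 ^ m := by positivity
      have h3 : (c1 + c2) * (Q1 ^ m - Q2 ^ m) ≤
          m * (c1 + c2) ^ 2 * (Q1 ^ (m - 1) + Q2 ^ (m - 1)) := by
        calc _ ≤ |(c1 + c2) * (Q1 ^ m - Q2 ^ m)| := le_abs_self _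
          _ = |c1 + c2| * |Q1 ^ m - Q2 ^ m| := abs_mul _ _
          _ ≤ |c1 + c2| * (m * |c1 + c2| * (Q1 ^ (m - 1) + Q2 ^ (m - 1))) := by gcongr
          _ = m * |c1 + c2| ^ 2 * (Q1 ^ (m - 1) + Q2 ^ (m - 1)) := by ring
          _ = _ := by rw [sq_abs]
      have h4 : (c1 + c2) ^ 2 ≤ 8 * c1 ^ 2 + 2 * B j ω ^ 2 := by
        rw [← hcd]; nlinarith [sq_nonneg (3 * c1 - c2)]
      have h5 : (c1 + c2) ^ 2 ≤ 8 * c2 ^ 2 + 2 * B j ω ^ 2 := by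
        rw [← hcd]; nlinarith [sq_nonneg (3 * c2 - c1)]
      have h6 : (c1 + c2) ^ 2 * (Q1 ^ (m - 1) + Q2 ^ (m - 1)) ≤
          (8 * c1 ^ 2 + 2 * B j ω ^ 2) * Q1 ^ (m - 1) +
          (8 * c2 ^ 2 + 2 * B j ω ^ 2) * Q2 ^ (m - 1) := by
        linarith [mul_le_mul_of_nonneg_right h4 hP1, mul_le_mul_of_nonneg_right h5 hP2]
      have h7 := mul_le_mul_of_nonneg_left h6 (Nat.cast_nonneg (α := ℝ) m)
      have h8 : 2 * (c1 * Q1 ^ m - c2 * Q2 ^ m) =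
          B j ω * (Q1 ^ m + Q2 ^ m) + (c1 + c2) * (Q1 ^ m - Q2 ^ m) := by
        rw [← hcd]; ring
      have h9 : c1 * Q1 ^ m - c2 * Q2 ^ m ≤
          (B j ω * Q1 ^ m + m * (4 * c1 ^ 2 + B j ω ^ 2) * Q1 ^ (m - 1)) +
          (B j ω * Q2 ^ m + m * (4 * c2 ^ 2 + B j ω ^ 2) * Q2 ^ (m - 1)) := by
        linarith [mul_nonneg hB1 hR1, mul_nonneg hB1 hR2]
      linarith [mul_le_mul_of_nonneg_left h9 hg1]
  rw [h1]
  calc _ ≤ ∑ j, bernoulliExpect p (fun ω => g ω * (B j ω * Q ω ^ m +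
        m * (4 * c j ω ^ 2 + B j ω ^ 2) * Q ω ^ (m - 1))) :=
        Finset.sum_le_sum fun j _ => h2 j
    _ = bernoulliExpect p (fun ω => g ω * (T ω * Q ω ^ m +
        m * (4 * ∑ j, c j ω ^ 2 + ∑ j, B j ω ^ 2) * Q ω ^ (m - 1))) := by
        rw [← bernoulliExpect_sum]
        congr 1
        ext ω
        rw [← Finset.mul_sum, Finset.sum_add_distrib, ← Finset.sum_mul, ← Finset.sum_mul,
          ← Finset.mul_sum, Finset.sum_add_distrib, ← Finset.mul_sum, hTB]
    _ ≤ _ := by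
        refine bernoulliExpect_mono hp fun ω => ?_
        have hcs : ∑ j, c j ω ^ 2 ≤ b ω * Q ω := hb ω fun k => L k ω
        have hBs : ∑ j, B j ω ^ 2 ≤ b ω * T ω := by
          rw [hTB, Finset.mul_sum]
          refine Finset.sum_le_sum fun j _ => ?_
          refine le_trans ?_ (hb ω fun k => A k j ω)
          refine le_trans (le_of_eq ?_) (Finset.single_le_sum
            (f := fun j' => (∑ k, A k j' ω * A k j ω) ^ 2) (fun _ _ => sq_nonneg _) (mem_univ j))
          simp only [hB, sq]
        have hq : (m : ℝ) * (Q ω * Q ω ^ (m - 1)) = m * Q ω ^ m := by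
          cases m with
          | zero => simp
          | succ m => rw [Nat.add_sub_cancel, ← pow_succ']
        have hP : 0 ≤ m * Q ω ^ (m - 1) :=
          mul_nonneg (Nat.cast_nonneg _) (pow_nonneg (hQ0 ω) _)
        have h3 := mul_le_mul_of_nonneg_right
          (add_le_add (mul_le_mul_of_nonneg_left hcs (zero_le_four (α := ℝ))) hBs) hP
        have h4 : T ω * Q ω ^ m + m * (4 * ∑ j, c j ω ^ 2 + ∑ j, B j ω ^ 2) * Q ω ^ (m - 1) ≤
            (T ω + 4 * m * b ω) * Q ω ^ m + (m * b ω * T ω) * Q ω ^ (m - 1) := by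
          have h5 : (4 * (b ω * Q ω) + b ω * T ω) * (m * Q ω ^ (m - 1)) =
            4 * m * b ω * Q ω ^ m + (m * b ω * T ω) * Q ω ^ (m - 1) := by
            linear_combination 4 * b ω * hq
          linarith
        linarith [mul_le_mul_of_nonneg_left h4 (hg ω)]

/-- Moments of the squared length of a random linear image, in terms of the Hilbert–Schmidt
norm and a bound on the operator norm. -/
theorem bernoulliExpect_quadratic_pow_le {K : Type*} [Fintype K]
    (hp : ∀ i, p i ∈ Set.Icc (0 : ℝ) 1) (he : Function.Injective e)
    (A : K → J → (ι → Bool) → ℝ) (hA : ∀ k j, FreeOf e (A k j)) (b : (ι → Bool) → ℝ)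
    (hb0 : ∀ ω, 0 ≤ b ω) (hbf : FreeOf e b)
    (hb : ∀ ω (w : K → ℝ), ∑ j, (∑ k, A k j ω * w k) ^ 2 ≤ b ω * ∑ k, w k ^ 2) (m : ℕ)
    (g : (ι → Bool) → ℝ) (hg : ∀ ω, 0 ≤ g ω) (hgf : FreeOf e g) :
    bernoulliExpect p (fun ω =>
        g ω * (∑ k, (∑ j, A k j ω * coordCentred p (e j) ω) ^ 2) ^ m) ≤
      bernoulliExpect p (fun ω =>
        g ω * (2 * (∑ k, ∑ j, A k j ω ^ 2 + 4 * m * b ω)) ^ m) := by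
  set Q : (ι → Bool) → ℝ :=
    fun ω => ∑ k, (∑ j, A k j ω * coordCentred p (e j) ω) ^ 2 with hQ
  set T : (ι → Bool) → ℝ := fun ω => ∑ k, ∑ j, A k j ω ^ 2 with hT
  have hT0 : ∀ ω, 0 ≤ T ω := fun ω =>
    Finset.sum_nonneg fun k _ => Finset.sum_nonneg fun j _ => sq_nonneg _
  have hTf : FreeOf e T := fun j c ω =>
    Finset.sum_congr rfl fun k _ => Finset.sum_congr rfl fun j' _ => by rw [hA k j']
  suffices h : ∀ k ≤ m, ∀ g : (ι → Bool) → ℝ, (∀ ω, 0 ≤ g ω) → FreeOf e g →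
      bernoulliExpect p (fun ω => g ω * Q ω ^ k) ≤
        bernoulliExpect p (fun ω => g ω * (2 * (T ω + 4 * m * b ω)) ^ k) from
    h m le_rfl g hg hgf
  intro k
  induction k using Nat.strong_induction_on with
  | _ k ih =>
    intro hk g hg hgf
    cases k with
    | zero => simp
    | succ k =>
      have hk' : (k : ℝ) ≤ m := by exact_mod_cast (Nat.le_succ k).trans hk
      refine (bernoulliExpect_quadratic_pow_succ_le hp he A hA b hb k g hg hgf).trans ?_
      rw [bernoulliExpect_add]
      refine (add_le_add
        (ih k (Nat.lt_succ_self k) (by omega) (fun ω => g ω * (T ω + 4 * k * b ω)) ?_ ?_)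
        (ih (k - 1) (by omega) (by omega) (fun ω => g ω * (k * b ω * T ω)) ?_ ?_)).trans ?_
      · intro ω
        have := hg ω
        have := hT0 ω
        have := hb0 ω
        positivity
      · intro j c ω
        simp only [hgf j c ω, hTf j c ω, hbf j c ω]
      · intro ω
        have := hg ω
        have := hT0 ω
        have := hb0 ω
        positivity
      · intro j c ω
        simp only [hgf j c ω, hTf j c ω, hbf j c ω]
      · rw [← bernoulliExpect_add]
        refine bernoulliExpect_mono hp fun ω => ?_
        have hb1 := hb0 ω
        have hT1 := hT0 ω
        generalize hD : T ω + 4 * m * b ω = D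
        have hD0 : 0 ≤ D := by rw [← hD]; positivity
        have hkD : T ω + 4 * k * b ω ≤ D := by rw [← hD]; gcongr
        rw [mul_assoc (g ω) (T ω + _), mul_assoc (g ω) (k * b ω * T ω), ← mul_add]
        refine mul_le_mul_of_nonneg_left ?_ (hg ω)
        cases k with
        | zero =>
          simp only [pow_zero, zero_add, pow_one, mul_one, Nat.cast_zero, zero_mul, mul_zero,
            add_zero] at hkD ⊢
          linarith
        | succ k =>
          rw [Nat.add_sub_cancel]
          have h1 : ((k + 1 : ℕ) : ℝ) * b ω * T ω ≤ D ^ 2 := by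
            have h2 : ((k + 1 : ℕ) : ℝ) * b ω * T ω ≤ m * b ω * T ω := by gcongr
            have h3 : 0 ≤ m * b ω := by positivity
            rw [← hD]
            nlinarith [mul_nonneg h3 hT1, mul_nonneg h3 h3, mul_nonneg hT1 hT1]
          have hpk : 0 ≤ (2 * D) ^ k := by positivity
          have h4 : (2 * D) ^ (k + 1) = 2 * D * (2 * D) ^ k := pow_succ' _ _
          have h5 : (2 * D) ^ (k + 1 + 1) = 4 * D ^ 2 * (2 * D) ^ k := by rw [pow_succ', h4]; ring
          rw [h4, h5]
          have h6 : (T ω + 4 * ((k + 1 : ℕ) : ℝ) * b ω) * (2 * D) ≤ 2 * D ^ 2 := by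
            nlinarith [mul_le_mul_of_nonneg_right hkD hD0]
          nlinarith [mul_le_mul_of_nonneg_right h1 hpk, mul_le_mul_of_nonneg_right h6 hpk,
            mul_nonneg (sq_nonneg D) hpk]

end Moments

/-- The integer `± k` encoded by a sign and an absolute value. -/
def signedVal (z : Bool × ℕ) : ℝ := if z.1 then (z.2 : ℝ) else -(z.2 : ℝ)

theorem signedVal_sq (z : Bool × ℕ) : signedVal z ^ 2 = (z.2 : ℝ) ^ 2 := by
  unfold signedVal
  split_ifs <;> ring

/-- The integer vectors of squared length at most `4 * n`. -/
def integerNet (α : Type*) [Fintype α] [DecidableEq α] (n : ℕ) : Finset (α → Bool × ℕ) :=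
  (Fintype.piFinset fun _ : α => (univ : Finset Bool) ×ˢ Finset.range (2 * n + 1)).filter
    fun z => ∑ a, signedVal (z a) ^ 2 ≤ 4 * n

theorem integerNet_nonempty (α : Type*) [Fintype α] [DecidableEq α] (n : ℕ) :
    (integerNet α n).Nonempty :=
  ⟨fun _ => (true, 0), by simp [integerNet, signedVal]⟩

theorem card_integerNet_le (α : Type*) [Fintype α] [DecidableEq α] {n : ℕ}
    (hα : Fintype.card α ≤ n) : ((integerNet α n).card : ℝ) ≤ 64 ^ n := by
  have hgeom : ∑ z ∈ (univ : Finset Bool) ×ˢ Finset.range (2 * n + 1),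
      (1 / 2 : ℝ) ^ z.2 ≤ 4 := by
    rw [Finset.sum_product]
    have := sum_geometric_two_le (2 * n + 1)
    simp only [Fintype.sum_bool]
    linarith
  have h1 : ∀ z ∈ integerNet α n, (1 : ℝ) ≤ 16 ^ n * ∏ a, (1 / 2 : ℝ) ^ (z a).2 := by
    intro z hz
    have hz2 := (Finset.mem_filter.1 hz).2
    have h2 : ∑ a, (z a).2 ≤ 4 * n := by
      have : ∑ a, ((z a).2 : ℝ) ≤ 4 * n := by
        refine le_trans (Finset.sum_le_sum fun a _ => ?_) hz2
        rw [signedVal_sq]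
        exact_mod_cast Nat.le_self_pow two_ne_zero _
      exact_mod_cast this
    rw [Finset.prod_pow_eq_pow_sum]
    calc (1 : ℝ) = 16 ^ n * (1 / 2) ^ (4 * n) := by
          rw [pow_mul, ← mul_pow]; norm_num
      _ ≤ _ := by
          refine mul_le_mul_of_nonneg_left ?_ (by positivity)
          exact pow_le_pow_of_le_one (by norm_num) (by norm_num) h2
  calc ((integerNet α n).card : ℝ) = ∑ z ∈ integerNet α n, (1 : ℝ) := by simp
    _ ≤ ∑ z ∈ integerNet α n, 16 ^ n * ∏ a, (1 / 2 : ℝ) ^ (z a).2 := Finset.sum_le_sum h1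
    _ ≤ ∑ z ∈ Fintype.piFinset fun _ : α => (univ : Finset Bool) ×ˢ Finset.range (2 * n + 1),
        16 ^ n * ∏ a, (1 / 2 : ℝ) ^ (z a).2 :=
        Finset.sum_le_sum_of_subset_of_nonneg (Finset.filter_subset _ _)
          fun _ _ _ => by positivity
    _ = 16 ^ n * (∑ z ∈ (univ : Finset Bool) ×ˢ Finset.range (2 * n + 1),
          (1 / 2 : ℝ) ^ z.2) ^ Fintype.card α := by
        rw [← Finset.mul_sum, Finset.sum_prod_piFinset
          ((univ : Finset Bool) ×ˢ Finset.range (2 * n + 1)) (fun _ z => (1 / 2 : ℝ) ^ z.2)]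
        simp
    _ ≤ 16 ^ n * 4 ^ Fintype.card α := by gcongr
    _ ≤ 16 ^ n * 4 ^ n := by gcongr; norm_num
    _ = 64 ^ n := by rw [← mul_pow]; norm_num

theorem exists_mem_integerNet {α : Type*} [Fintype α] [DecidableEq α] {n : ℕ} (hn : 1 ≤ n)
    (u : α → ℝ) (hu : ∑ a, u a ^ 2 = 1) :
    ∃ z ∈ integerNet α n, ∀ a, |2 * √n * u a - signedVal (z a)| ≤ 1 := by
  set v : α → ℝ := fun a => 2 * √n * u a with hv
  have hv2 : ∑ a, v a ^ 2 = 4 * n := by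
    simp only [hv, mul_pow, ← Finset.mul_sum, hu]
    rw [Real.sq_sqrt (Nat.cast_nonneg n)]
    ring
  have hfl : ∀ a, ((⌊|v a|⌋₊ : ℕ) : ℝ) ≤ |v a| := fun a => Nat.floor_le (abs_nonneg _)
  have hfl2 : ∀ a, ((⌊|v a|⌋₊ : ℕ) : ℝ) ^ 2 ≤ v a ^ 2 := fun a => by
    rw [← sq_abs (v a)]
    exact pow_le_pow_left₀ (Nat.cast_nonneg _) (hfl a) 2
  refine ⟨fun a => (decide (0 ≤ v a), ⌊|v a|⌋₊), ?_, fun a => ?_⟩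
  · refine Finset.mem_filter.2 ⟨?_, ?_⟩
    · refine Fintype.mem_piFinset.2 fun a => Finset.mem_product.2 ⟨mem_univ _, ?_⟩
      have h1 : v a ^ 2 ≤ 4 * n := by
        rw [← hv2]
        exact Finset.single_le_sum (f := fun a => v a ^ 2) (fun _ _ => sq_nonneg _) (mem_univ a)
      have h2 : ⌊|v a|⌋₊ ^ 2 ≤ 4 * n := by exact_mod_cast (hfl2 a).trans h1
      simp only [Finset.mem_range]
      nlinarith
    · rw [← hv2]
      refine Finset.sum_le_sum fun a _ => ?_
      rw [signedVal_sq]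
      exact hfl2 a
  · have h1 := hfl a
    have h2 := (Nat.lt_floor_add_one |v a|).le
    change |v a - _| ≤ 1
    by_cases h : 0 ≤ v a
    · rw [abs_of_nonneg h] at h1 h2
      simp only [signedVal, h, decide_true, if_true, abs_of_nonneg h]
      rw [abs_le]
      constructor <;> linarith
    · have h' := (not_le.1 h).le
      rw [abs_of_nonpos h'] at h1 h2
      simp only [signedVal, h, decide_false, Bool.false_eq_true, if_false, abs_of_nonpos h']
      rw [abs_le]
      constructor <;> linarith

/-- The operator norm of a matrix is controlled by its values on the integer net. -/
theorem sum_sq_mulVec_le_of_integerNet {α β : Type*} [Fintype α] [DecidableEq α] [Fintype β]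
    {n : ℕ} (hn : 1 ≤ n) (hα : Fintype.card α ≤ n) (X : β → α → ℝ) (s : ℝ) (hs : 0 ≤ s)
    (h : ∀ z ∈ integerNet α n, ∑ b, (∑ a, X b a * signedVal (z a)) ^ 2 ≤ n * s) (w : α → ℝ) :
    ∑ b, (∑ a, X b a * w a) ^ 2 ≤ s * ∑ a, w a ^ 2 := by
  have hn0 : (0 : ℝ) < n := by exact_mod_cast hn
  have hsn : 0 < √(n : ℝ) := Real.sqrt_pos.2 hn0
  set T : EuclideanSpace ℝ α →L[ℝ] EuclideanSpace ℝ β :=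
    LinearMap.toContinuousLinearMap (Matrix.toEuclideanLin (Matrix.of X)) with hT
  have hTn : ∀ v : EuclideanSpace ℝ α, ‖T v‖ ^ 2 = ∑ b, (∑ a, X b a * v a) ^ 2 := by
    intro v
    rw [EuclideanSpace.norm_sq_eq]
    refine Finset.sum_congr rfl fun b _ => ?_
    rw [Real.norm_eq_abs, sq_abs]
    rfl
  have hunit : ∀ u : EuclideanSpace ℝ α, ‖u‖ = 1 → ‖T u‖ ≤ √s / 2 + ‖T‖ / 2 := by
    intro u hu
    have hu2 : ∑ a, u a ^ 2 = 1 := by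
      have := EuclideanSpace.norm_sq_eq u
      rw [hu] at this
      simpa using this.symm
    obtain ⟨z, hz, hzu⟩ := exists_mem_integerNet hn (fun a => u a) hu2
    set y : EuclideanSpace ℝ α := WithLp.toLp 2 fun a => signedVal (z a) with hy
    have h1 : ‖T y‖ ≤ √n * √s := by
      rw [← Real.sqrt_mul hn0.le]
      refine Real.le_sqrt_of_sq_le ?_
      rw [hTn]
      exact h z hz
    have h2 : ‖(2 * √n) • u - y‖ ≤ √n := by
      refine Real.le_sqrt_of_sq_le ?_
      rw [EuclideanSpace.norm_sq_eq]
      calc _ ≤ ∑ a : α, (1 : ℝ) := by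
            refine Finset.sum_le_sum fun a _ => ?_
            have : |2 * √n * u a - signedVal (z a)| ^ 2 ≤ 1 :=
              pow_le_one₀ (abs_nonneg _) (hzu a)
            simpa [hy] using this
        _ ≤ n := by simpa using hα
    have h3 : ‖T ((2 * √n) • u)‖ ≤ √n * √s + ‖T‖ * √n := by
      have : (2 * √n) • u = y + ((2 * √n) • u - y) := by abel
      rw [this, map_add]
      refine (norm_add_le _ _).trans (add_le_add h1 ?_)
      exact (T.le_opNorm _).trans (by gcongr)
    rw [map_smul, norm_smul, Real.norm_of_nonneg (by positivity)] at h3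
    have h4 : √n * (2 * ‖T u‖) ≤ √n * (√s + ‖T‖) := by linarith
    have := le_of_mul_le_mul_left h4 hsn
    linarith
  have hop : ‖T‖ ≤ √s / 2 + ‖T‖ / 2 := by
    refine T.opNorm_le_bound (by positivity) fun v => ?_
    by_cases hv : v = 0
    · simp [hv]
    · have hv0 : 0 < ‖v‖ := norm_pos_iff.2 hv
      have := hunit (‖v‖⁻¹ • v) (by rw [norm_smul, norm_inv, norm_norm, inv_mul_cancel₀ hv0.ne'])
      rw [map_smul, norm_smul, norm_inv, norm_norm, inv_mul_le_iff₀ hv0] at this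
      linarith
  have hop' : ‖T‖ ≤ √s := by linarith
  have h5 := T.le_opNorm (WithLp.toLp 2 w)
  have h6 : ‖T (WithLp.toLp 2 w)‖ ^ 2 ≤ (√s * ‖(WithLp.toLp 2 w : EuclideanSpace ℝ α)‖) ^ 2 :=
    pow_le_pow_left₀ (norm_nonneg _) (h5.trans (by gcongr)) 2
  rw [hTn, mul_pow, Real.sq_sqrt hs, EuclideanSpace.norm_sq_eq] at h6
  simpa using h6

/-- An upper bound for the squared operator norm of a matrix, computed on the integer net. -/
def netBound {α β : Type*} [Fintype α] [DecidableEq α] [Fintype β] (n : ℕ)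
    (X : β → α → ℝ) : ℝ :=
  (integerNet α n).sup' (integerNet_nonempty α n)
    (fun z => ∑ b, (∑ a, X b a * signedVal (z a)) ^ 2) / n

section NetBound

variable {α β : Type*} [Fintype α] [DecidableEq α] [Fintype β] {n : ℕ}

theorem exists_netBound_eq (n : ℕ) (X : β → α → ℝ) : ∃ z ∈ integerNet α n,
    netBound n X = (∑ b, (∑ a, X b a * signedVal (z a)) ^ 2) / n := by
  obtain ⟨z, hz, h⟩ := Finset.exists_mem_eq_sup' (integerNet_nonempty α n)
    (fun z => ∑ b, (∑ a, X b a * signedVal (z a)) ^ 2)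
  exact ⟨z, hz, by rw [netBound, h]⟩

theorem netBound_nonneg (X : β → α → ℝ) : 0 ≤ netBound n X := by
  obtain ⟨z, -, h⟩ := exists_netBound_eq n X
  rw [h]
  positivity

theorem sum_sq_le_netBound (hn : 1 ≤ n) (hα : Fintype.card α ≤ n) (X : β → α → ℝ)
    (w : α → ℝ) : ∑ b, (∑ a, X b a * w a) ^ 2 ≤ netBound n X * ∑ a, w a ^ 2 := by
  refine sum_sq_mulVec_le_of_integerNet hn hα X _ (netBound_nonneg X) (fun z hz => ?_) w
  have hn0 : (0 : ℝ) < n := by exact_mod_cast hn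
  rw [netBound, mul_div_cancel₀ _ hn0.ne']
  exact Finset.le_sup' (fun z => ∑ b, (∑ a, X b a * signedVal (z a)) ^ 2) hz

theorem netBound_pow_le (X : β → α → ℝ) (m : ℕ) : netBound n X ^ m ≤
    ∑ z ∈ integerNet α n, ((∑ b, (∑ a, X b a * signedVal (z a)) ^ 2) / n) ^ m := by
  obtain ⟨z, hz, h⟩ := exists_netBound_eq n X
  rw [h]
  exact Finset.single_le_sum
    (f := fun z : α → Bool × ℕ => ((∑ b, (∑ a, X b a * signedVal (z a)) ^ 2) / (n : ℝ)) ^ m)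
    (fun _ _ => by positivity) hz

end NetBound

section RandomMatrix

variable {ι α β : Type*} [Fintype ι] [DecidableEq ι] [Fintype α] [Fintype β] [DecidableEq β]
  {p : ι → ℝ} {e : α × β → ι} {n : ℕ}

/-- Moments of the squared length of the image of a fixed vector under a random matrix. -/
theorem bernoulliExpect_mulVec_pow_le (hp : ∀ i, p i ∈ Set.Icc (0 : ℝ) 1)
    (he : Function.Injective e) (hβ : Fintype.card β ≤ n) (z : α → ℝ) (s : ℝ)
    (hz : ∑ a, z a ^ 2 ≤ s) (m : ℕ) :
    bernoulliExpect p (fun ω =>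
        (∑ b, (∑ a, coordCentred p (e (a, b)) ω * z a) ^ 2) ^ m) ≤
      (2 * (s * (n + 4 * m))) ^ m := by
  have hz0 : 0 ≤ ∑ a, z a ^ 2 := Finset.sum_nonneg fun _ _ => sq_nonneg _
  have hs0 := hz0.trans hz
  have h := bernoulliExpect_quadratic_pow_le hp he
    (fun (b : β) (j : α × β) _ => if j.2 = b then z j.1 else 0) (fun _ _ _ _ _ => rfl)
    (fun _ => s) (fun _ => hs0) (fun _ _ _ => rfl) (fun _ w => by
      simp only [ite_mul, zero_mul, Finset.sum_ite_eq, mem_univ, if_true,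
        Fintype.sum_prod_type, mul_pow, ← Finset.mul_sum, ← Finset.sum_mul]
      exact mul_le_mul_of_nonneg_right hz (Finset.sum_nonneg fun _ _ => sq_nonneg _))
    m (fun _ => 1) (fun _ => zero_le_one) (fun _ _ _ => rfl)
  simp only [ite_mul, zero_mul, Fintype.sum_prod_type, one_mul, ite_pow, ne_eq,
    OfNat.ofNat_ne_zero, not_false_eq_true, zero_pow, bernoulliExpect_const,
    Finset.sum_ite_eq', mem_univ, if_true, Finset.sum_const, card_univ, nsmul_eq_mul] at h
  have hβ' : (Fintype.card β : ℝ) ≤ n := by exact_mod_cast hβ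
  calc _ = _ := by simp only [mul_comm (coordCentred p _ _)]
    _ ≤ _ := h
    _ ≤ _ := by
      refine pow_le_pow_left₀ (by positivity) ?_ m
      have : (Fintype.card β : ℝ) * ∑ a, z a ^ 2 ≤ n * s := by gcongr
      linarith

/-- Moments of the operator norm of a random matrix. -/
theorem bernoulliExpect_netBound_pow_le [DecidableEq α] (hp : ∀ i, p i ∈ Set.Icc (0 : ℝ) 1)
    (he : Function.Injective e) (hn : 1 ≤ n) (hα : Fintype.card α ≤ n)
    (hβ : Fintype.card β ≤ n) (m : ℕ) :
    bernoulliExpect p (fun ω =>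
        (netBound n fun b a => coordCentred p (e (a, b)) ω) ^ m) ≤
      2 * (2560 * (n + m)) ^ m := by
  have hn0 : (0 : ℝ) < n := by exact_mod_cast hn
  set B : (ι → Bool) → ℝ := fun ω => netBound n fun b a => coordCentred p (e (a, b)) ω with hB
  have hB0 : ∀ ω, 0 ≤ B ω := fun ω => netBound_nonneg _
  set l : ℝ := 2560 * (n + m) with hl
  have hl0 : 0 < l := by positivity
  have h1 : bernoulliExpect p (fun ω => B ω ^ (m + n)) ≤ l ^ (m + n) := by
    calc _ ≤ bernoulliExpect p (fun ω => ∑ z ∈ integerNet α n, (1 / (n : ℝ) ^ (m + n)) *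
          (∑ b, (∑ a, coordCentred p (e (a, b)) ω * signedVal (z a)) ^ 2) ^ (m + n)) := by
          refine bernoulliExpect_mono hp fun ω => (netBound_pow_le _ _).trans (le_of_eq ?_)
          refine Finset.sum_congr rfl fun z _ => ?_
          rw [div_pow]
          ring
      _ = ∑ z ∈ integerNet α n, (1 / (n : ℝ) ^ (m + n)) * bernoulliExpect p (fun ω =>
          (∑ b, (∑ a, coordCentred p (e (a, b)) ω * signedVal (z a)) ^ 2) ^ (m + n)) := by
          rw [bernoulliExpect_sum]
          exact Finset.sum_congr rfl fun z _ => bernoulliExpect_const_mul _ _ _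
      _ ≤ ∑ z ∈ integerNet α n, (1 / (n : ℝ) ^ (m + n)) *
          (2 * (4 * n * (n + 4 * (m + n : ℕ)))) ^ (m + n) := by
          refine Finset.sum_le_sum fun z hz => mul_le_mul_of_nonneg_left ?_ (by positivity)
          exact bernoulliExpect_mulVec_pow_le hp he hβ _ _ (Finset.mem_filter.1 hz).2 _
      _ = (integerNet α n).card * (8 * (n + 4 * (m + n : ℕ)) : ℝ) ^ (m + n) := by
          rw [Finset.sum_const, nsmul_eq_mul]
          congr 1
          rw [div_mul_eq_mul_div, one_mul, ← div_pow]
          congr 1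
          field_simp
          ring
      _ ≤ 64 ^ (m + n) * (8 * (n + 4 * (m + n : ℕ)) : ℝ) ^ (m + n) := by
          refine mul_le_mul_of_nonneg_right ((card_integerNet_le α hα).trans ?_) (by positivity)
          exact pow_le_pow_right₀ (by norm_num) (by omega)
      _ ≤ l ^ (m + n) := by
          rw [← mul_pow]
          refine pow_le_pow_left₀ (by positivity) ?_ _
          push_cast
          rw [hl]
          have : (0 : ℝ) ≤ m := Nat.cast_nonneg m
          linarith
  calc _ ≤ bernoulliExpect p (fun ω => l ^ m + (1 / l ^ n) * B ω ^ (m + n)) := by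
        refine bernoulliExpect_mono hp fun ω => ?_
        rcases le_total (B ω) l with h | h
        · have h2 := pow_le_pow_left₀ (hB0 ω) h m
          have h3 : 0 ≤ 1 / l ^ n * B ω ^ (m + n) := by have := hB0 ω; positivity
          linarith
        · have h2 : 1 ≤ (1 / l ^ n) * B ω ^ n := by
            rw [one_div, ← div_eq_inv_mul, one_le_div (by positivity)]
            exact pow_le_pow_left₀ hl0.le h n
          have h3 := mul_le_mul_of_nonneg_left h2 (pow_nonneg (hB0 ω) m)
          have h4 : 0 ≤ l ^ m := by positivity
          rw [pow_add]
          linarith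
    _ = l ^ m + (1 / l ^ n) * bernoulliExpect p (fun ω => B ω ^ (m + n)) := by
        rw [bernoulliExpect_add, bernoulliExpect_const, bernoulliExpect_const_mul]
    _ ≤ l ^ m + (1 / l ^ n) * l ^ (m + n) := by gcongr
    _ = 2 * l ^ m := by
        rw [pow_add]
        field_simp
        ring

end RandomMatrix

theorem add_pow_le_two_pow_mul {u v : ℝ} (hu : 0 ≤ u) (hv : 0 ≤ v) (m : ℕ) :
    (u + v) ^ m ≤ 2 ^ m * (u ^ m + v ^ m) :=
  (add_pow_le hu hv m).trans (mul_le_mul_of_nonneg_right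
    (pow_le_pow_right₀ one_le_two (Nat.sub_le m 1)) (by positivity))

theorem mul_pow_le_mul_pow {c y : ℝ} (hc : 1 ≤ c) (hy : 0 ≤ y) {m : ℕ} (hm : m ≠ 0) :
    c * y ^ m ≤ (c * y) ^ m := by
  rw [mul_pow]
  exact mul_le_mul_of_nonneg_right (le_self_pow₀ hc hm) (by positivity)

theorem add_sq_le_two_mul (x y : ℝ) : (x + y) ^ 2 ≤ 2 * x ^ 2 + 2 * y ^ 2 := by
  nlinarith [sq_nonneg (x - y)]

theorem coordInd_update_of_ne {ι : Type*} [DecidableEq ι] {i i' : ι} (h : i ≠ i') (b : Bool)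
    (ω : ι → Bool) : coordInd i (Function.update ω i' b) = coordInd i ω := by
  simp [coordInd, h]

theorem coordInd_eq {ι : Type*} (p : ι → ℝ) (i : ι) (ω : ι → Bool) :
    coordInd i ω = coordCentred p i ω + p i := by
  simp [coordCentred]

theorem coordInd_sq_le_one {ι : Type*} (i : ι) (ω : ι → Bool) : coordInd i ω ^ 2 ≤ 1 := by
  unfold coordInd
  split_ifs <;> norm_num

/-- The scale of the `2 * m`-th moments of the triangle count. -/
def momentScale (n : ℕ) (q : ℝ) (m : ℕ) : ℝ :=
  m * (n ^ 3 + q ^ 4 * n ^ 4) + m ^ 2 * (n + q ^ 2 * n ^ 2) + m ^ 3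

section Tripartite

variable {ι α β γ : Type*} [Fintype ι] [DecidableEq ι] [Fintype α] [DecidableEq α]
  [Fintype β] [DecidableEq β] [Fintype γ] [DecidableEq γ] {p : ι → ℝ} {q : ℝ} {n m : ℕ}

omit [DecidableEq α] in
/-- Moments of the sum of the squared degrees on one side of a random bipartite graph. -/
theorem bernoulliExpect_sum_degree_sq_pow_le (hp : ∀ i, p i ∈ Set.Icc (0 : ℝ) 1)
    {e : α × β → ι} (he : Function.Injective e) (hq : ∀ u, p (e u) = q)
    (hα : Fintype.card α ≤ n) (hβ : Fintype.card β ≤ n) (hm : m ≠ 0) :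
    bernoulliExpect p (fun ω => (∑ b, (∑ a, coordInd (e (a, b)) ω) ^ 2) ^ m) ≤
      (64 * (n ^ 2 + m * n + q ^ 2 * n ^ 3)) ^ m := by
  have hα' : (Fintype.card α : ℝ) ≤ n := by exact_mod_cast hα
  have hβ' : (Fintype.card β : ℝ) ≤ n := by exact_mod_cast hβ
  have h1 : ∀ ω, ∑ b, (∑ a, coordInd (e (a, b)) ω) ^ 2 ≤
      2 * ∑ b, (∑ a, coordCentred p (e (a, b)) ω * 1) ^ 2 + 2 * (q ^ 2 * n ^ 3) := by
    intro ω
    calc _ ≤ ∑ b : β, (2 * (∑ a, coordCentred p (e (a, b)) ω * 1) ^ 2 + 2 * (q * n) ^ 2) := by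
          refine Finset.sum_le_sum fun b _ => ?_
          have : ∑ a, coordInd (e (a, b)) ω =
              ∑ a, coordCentred p (e (a, b)) ω * 1 + Fintype.card α * q := by
            simp [coordInd_eq p, hq, Finset.sum_add_distrib]
          rw [this]
          refine (add_sq_le_two_mul _ _).trans ?_
          have : ((Fintype.card α : ℝ) * q) ^ 2 ≤ (q * n) ^ 2 := by
            rw [mul_pow, mul_pow, mul_comm]
            gcongr
          linarith
      _ = 2 * ∑ b, (∑ a, coordCentred p (e (a, b)) ω * 1) ^ 2 +
          Fintype.card β * (2 * (q * n) ^ 2) := by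
          rw [Finset.sum_add_distrib, ← Finset.mul_sum]; simp
      _ ≤ _ := by
          have : (Fintype.card β : ℝ) * (2 * (q * n) ^ 2) ≤ n * (2 * (q * n) ^ 2) := by gcongr
          linarith
  have h2 := bernoulliExpect_mulVec_pow_le hp he hβ (fun _ => 1) n (by simpa using hα') m
  set D : ℝ := n ^ 2 + m * n + q ^ 2 * n ^ 3 with hD
  have hD0 : 0 ≤ D := by positivity
  calc _ ≤ bernoulliExpect p (fun ω => 2 ^ m *
        (2 ^ m * (∑ b, (∑ a, coordCentred p (e (a, b)) ω * 1) ^ 2) ^ m +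
          (2 * (q ^ 2 * n ^ 3)) ^ m)) := by
        refine bernoulliExpect_mono hp fun ω => ?_
        rw [← mul_pow 2 (∑ b, _) m]
        exact (pow_le_pow_left₀ (by positivity) (h1 ω) m).trans
          (add_pow_le_two_pow_mul (by positivity) (by positivity) m)
    _ = 2 ^ m * (2 ^ m * bernoulliExpect p
          (fun ω => (∑ b, (∑ a, coordCentred p (e (a, b)) ω * 1) ^ 2) ^ m) +
          (2 * (q ^ 2 * n ^ 3)) ^ m) := by
        rw [bernoulliExpect_const_mul, bernoulliExpect_add, bernoulliExpect_const_mul,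
          bernoulliExpect_const]
    _ ≤ 2 ^ m * (2 ^ m * (2 * (n * (n + 4 * m))) ^ m + (2 * (q ^ 2 * n ^ 3)) ^ m) := by gcongr
    _ ≤ 2 ^ m * ((16 * D) ^ m + (16 * D) ^ m) := by
        rw [← mul_pow]
        have h3 : 0 ≤ q ^ 2 * (n : ℝ) ^ 3 := by positivity
        have h4 : (0 : ℝ) ≤ m * n := by positivity
        have h5 : (0 : ℝ) ≤ (n : ℝ) ^ 2 := by positivity
        have hA : 2 * (2 * ((n : ℝ) * (n + 4 * m))) ≤ 16 * D := by rw [hD]; nlinarith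
        have hB : 2 * (q ^ 2 * (n : ℝ) ^ 3) ≤ 16 * D := by rw [hD]; nlinarith
        exact mul_le_mul_of_nonneg_left (add_le_add (pow_le_pow_left₀ (by positivity) hA m)
          (pow_le_pow_left₀ (by positivity) hB m)) (by positivity)
    _ = 2 * (32 * D) ^ m := by
        rw [← two_mul, ← mul_assoc, mul_comm ((2 : ℝ) ^ m), mul_assoc, ← mul_pow]; ring
    _ ≤ (2 * (32 * D)) ^ m := mul_pow_le_mul_pow one_le_two (by positivity) hm
    _ = _ := by ring

omit [Fintype ι] [DecidableEq ι] [DecidableEq β] in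
theorem sum_sq_coordInd_le (hn : 1 ≤ n) {e : α × β → ι} (hq : ∀ u, p (e u) = q)
    (hα : Fintype.card α ≤ n) (hβ : Fintype.card β ≤ n) (ω : ι → Bool) (w : α → ℝ) :
    ∑ b, (∑ a, coordInd (e (a, b)) ω * w a) ^ 2 ≤
      (2 * (netBound n fun b a => coordCentred p (e (a, b)) ω) + 2 * (q ^ 2 * n ^ 2)) *
        ∑ a, w a ^ 2 := by
  have hα' : (Fintype.card α : ℝ) ≤ n := by exact_mod_cast hα
  have hβ' : (Fintype.card β : ℝ) ≤ n := by exact_mod_cast hβ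
  have hw : 0 ≤ ∑ a, w a ^ 2 := Finset.sum_nonneg fun _ _ => sq_nonneg _
  have hcs : (∑ a, w a) ^ 2 ≤ n * ∑ a, w a ^ 2 :=
    (sq_sum_le_card_mul_sum_sq (s := univ) (f := w)).trans
      (mul_le_mul_of_nonneg_right (by simpa using hα') hw)
  calc _ ≤ ∑ b : β, (2 * (∑ a, coordCentred p (e (a, b)) ω * w a) ^ 2 +
        2 * (q * ∑ a, w a) ^ 2) := by
        refine Finset.sum_le_sum fun b _ => ?_
        have : ∑ a, coordInd (e (a, b)) ω * w a =
            ∑ a, coordCentred p (e (a, b)) ω * w a + q * ∑ a, w a := by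
          simp [coordInd_eq p, hq, Finset.sum_add_distrib, add_mul, Finset.mul_sum]
        rw [this]
        exact add_sq_le_two_mul _ _
    _ = 2 * ∑ b, (∑ a, coordCentred p (e (a, b)) ω * w a) ^ 2 +
        Fintype.card β * (2 * (q ^ 2 * (∑ a, w a) ^ 2)) := by
        rw [Finset.sum_add_distrib, ← Finset.mul_sum]
        simp [mul_pow]
    _ ≤ 2 * ((netBound n fun b a => coordCentred p (e (a, b)) ω) * ∑ a, w a ^ 2) +
        n * (2 * (q ^ 2 * (n * ∑ a, w a ^ 2))) := by
        gcongr
        exact sum_sq_le_netBound hn hα (fun b a => coordCentred p (e (a, b)) ω) w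
    _ = _ := by ring

/-- Moments of the squared Hilbert–Schmidt norm of a product of two random matrices, the first
one not centred. -/
theorem bernoulliExpect_mul_centred_pow_le (hp : ∀ i, p i ∈ Set.Icc (0 : ℝ) 1) (hn : 1 ≤ n)
    {eX : α × β → ι} {eY : β × γ → ι} (heX : Function.Injective eX)
    (heY : Function.Injective eY) (hXY : ∀ u v, eX u ≠ eY v) (hq : ∀ u, p (eX u) = q)
    (hα : Fintype.card α ≤ n) (hβ : Fintype.card β ≤ n) (hγ : Fintype.card γ ≤ n)
    (hm : m ≠ 0) :
    bernoulliExpect p (fun ω => (∑ a, ∑ c,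
        (∑ b, coordInd (eX (a, b)) ω * coordCentred p (eY (b, c)) ω) ^ 2) ^ m) ≤
      (245760 * (n ^ 3 + m * n + m * (q ^ 2 * n ^ 2) + m ^ 2)) ^ m := by
  have hα' : (Fintype.card α : ℝ) ≤ n := by exact_mod_cast hα
  have hβ' : (Fintype.card β : ℝ) ≤ n := by exact_mod_cast hβ
  have hγ' : (Fintype.card γ : ℝ) ≤ n := by exact_mod_cast hγ
  set B : (ι → Bool) → ℝ :=
    fun ω => netBound n fun b a => coordCentred p (eX (a, b)) ω with hB
  have hB0 : ∀ ω, 0 ≤ B ω := fun ω => netBound_nonneg _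
  have hfree : ∀ u, FreeOf eY (coordInd (eX u)) := fun u v b ω =>
    coordInd_update_of_ne (hXY u v) b ω
  have hBfree : FreeOf eY B := fun v c ω => by
    have : ∀ u, coordCentred p (eX u) (Function.update ω (eY v) c) = coordCentred p (eX u) ω :=
      fun u => by rw [coordCentred, hfree u v c ω, coordCentred]
    simp only [hB, this]
  have h := bernoulliExpect_quadratic_pow_le hp heY
    (fun (k : α × γ) (j : β × γ) ω => if j.2 = k.2 then coordInd (eX (k.1, j.1)) ω else 0)
    (fun k j v b ω => by simp only [hfree (k.1, j.1) v b ω])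
    (fun ω => 2 * B ω + 2 * (q ^ 2 * n ^ 2))
    (fun ω => by have := hB0 ω; positivity)
    (fun v c ω => by simp only [hBfree v c ω]) (fun ω w => by
      simp only [ite_mul, zero_mul, Fintype.sum_prod_type, Finset.sum_ite_eq, mem_univ, if_true]
      rw [Finset.sum_comm, Finset.sum_comm (γ := α), Finset.mul_sum]
      exact Finset.sum_le_sum fun c _ =>
        sum_sq_coordInd_le hn hq hα hβ ω fun a => w (a, c))
    m (fun _ => 1) (fun _ => zero_le_one) (fun _ _ _ => rfl)
  simp only [ite_mul, zero_mul, Fintype.sum_prod_type, one_mul, ite_pow, ne_eq,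
    OfNat.ofNat_ne_zero, not_false_eq_true, zero_pow, Finset.sum_ite_eq', mem_univ,
    if_true] at h
  set G : ℝ := n ^ 3 + m * n + m * (q ^ 2 * n ^ 2) + m ^ 2 with hG
  have hG0 : 0 ≤ G := by positivity
  have hT : ∀ ω, ∑ a : α, ∑ _c : γ, ∑ b : β, coordInd (eX (a, b)) ω ^ 2 ≤ (n : ℝ) ^ 3 := by
    intro ω
    calc _ ≤ ∑ a : α, ∑ _c : γ, ∑ b : β, (1 : ℝ) := by
          gcongr
          exact coordInd_sq_le_one _ _
      _ = Fintype.card α * (Fintype.card γ * Fintype.card β) := by simp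
      _ ≤ n * (n * n) := by gcongr
      _ = _ := by ring
  refine h.trans ?_
  calc _ ≤ bernoulliExpect p (fun ω => 2 ^ m *
        ((2 * n ^ 3 + 16 * (m * (q ^ 2 * n ^ 2))) ^ m + (16 * m) ^ m * B ω ^ m)) := by
        refine bernoulliExpect_mono hp fun ω => ?_
        have hb := hB0 ω
        have hT0 : 0 ≤ ∑ a : α, ∑ _c : γ, ∑ b : β, coordInd (eX (a, b)) ω ^ 2 := by positivity
        rw [← mul_pow (16 * (m : ℝ))]
        refine le_trans (pow_le_pow_left₀ (by positivity) ?_ m)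
          (add_pow_le_two_pow_mul (by positivity) (by positivity) m)
        linarith [hT ω]
    _ = 2 ^ m * ((2 * n ^ 3 + 16 * (m * (q ^ 2 * n ^ 2))) ^ m +
          (16 * m) ^ m * bernoulliExpect p (fun ω => B ω ^ m)) := by
        rw [bernoulliExpect_const_mul, bernoulliExpect_add, bernoulliExpect_const_mul,
          bernoulliExpect_const]
    _ ≤ 2 ^ m * ((2 * n ^ 3 + 16 * (m * (q ^ 2 * n ^ 2))) ^ m +
          (16 * m) ^ m * (2 * (2560 * (n + m)) ^ m)) := by
        gcongr
        exact bernoulliExpect_netBound_pow_le hp heX hn hα hβ m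
    _ = 2 ^ m * ((2 * n ^ 3 + 16 * (m * (q ^ 2 * n ^ 2))) ^ m +
          2 * (40960 * (m * n + m ^ 2)) ^ m) := by
        rw [show (40960 * (m * n + m ^ 2) : ℝ) = (16 * m) * (2560 * (n + m)) by ring,
          mul_pow (16 * (m : ℝ))]
        ring
    _ ≤ 2 ^ m * ((40960 * G) ^ m + 2 * (40960 * G) ^ m) := by
        have h1 : 0 ≤ m * (q ^ 2 * (n : ℝ) ^ 2) := by positivity
        have h2 : (0 : ℝ) ≤ m * n := by positivity
        have h3 : (0 : ℝ) ≤ (n : ℝ) ^ 3 := by positivity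
        have h4 : (0 : ℝ) ≤ (m : ℝ) ^ 2 := by positivity
        have hA : 2 * (n : ℝ) ^ 3 + 16 * (m * (q ^ 2 * n ^ 2)) ≤ 40960 * G := by rw [hG]; linarith
        have hB : 40960 * ((m : ℝ) * n + m ^ 2) ≤ 40960 * G := by rw [hG]; linarith
        exact mul_le_mul_of_nonneg_left (add_le_add (pow_le_pow_left₀ (by positivity) hA m)
          (mul_le_mul_of_nonneg_left (pow_le_pow_left₀ (by positivity) hB m) zero_le_two))
          (by positivity)
    _ = 3 * (81920 * G) ^ m := by
        rw [show (81920 : ℝ) * G = 2 * (40960 * G) by ring, mul_pow 2]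
        ring
    _ ≤ (3 * (81920 * G)) ^ m := mul_pow_le_mul_pow (by norm_num) (by positivity) hm
    _ = _ := by ring

end Tripartite

section TripartiteTriangles

variable {ι α β γ : Type*} [Fintype ι] [DecidableEq ι] [Fintype α] [DecidableEq α]
  [Fintype β] [DecidableEq β] [Fintype γ] [DecidableEq γ] {p : ι → ℝ} {q : ℝ} {n m : ℕ}
  {eX : α × β → ι} {eY : β × γ → ι} {eZ : α × γ → ι}

theorem momentScale_nonneg (n : ℕ) (q : ℝ) (m : ℕ) : 0 ≤ momentScale n q m := by
  unfold momentScale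
  positivity

theorem add_add_pow_two_mul_le (x y z : ℝ) (m : ℕ) :
    (x + y + z) ^ (2 * m) ≤ 12 ^ m * (x ^ (2 * m) + y ^ (2 * m) + z ^ (2 * m)) := by
  have h : (x + y + z) ^ 2 ≤ 3 * (x ^ 2 + (y ^ 2 + z ^ 2)) := by
    nlinarith [sq_nonneg (x - y), sq_nonneg (x - z), sq_nonneg (y - z)]
  simp only [pow_mul]
  have hx : 0 ≤ (x ^ 2) ^ m := by positivity
  have h1 : (1 : ℝ) ≤ 2 ^ m := one_le_pow₀ one_le_two
  calc ((x + y + z) ^ 2) ^ m ≤ (3 * (x ^ 2 + (y ^ 2 + z ^ 2))) ^ m :=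
        pow_le_pow_left₀ (sq_nonneg _) h m
    _ = 3 ^ m * (x ^ 2 + (y ^ 2 + z ^ 2)) ^ m := mul_pow _ _ _
    _ ≤ 3 ^ m * (2 ^ m * ((x ^ 2) ^ m + 2 ^ m * ((y ^ 2) ^ m + (z ^ 2) ^ m))) := by
        gcongr
        exact (add_pow_le_two_pow_mul (by positivity) (by positivity) m).trans
          (by gcongr; exact add_pow_le_two_pow_mul (by positivity) (by positivity) m)
    _ ≤ 3 ^ m * (2 ^ m * (2 ^ m * (x ^ 2) ^ m + 2 ^ m * ((y ^ 2) ^ m + (z ^ 2) ^ m))) := by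
        gcongr
        nlinarith
    _ = (3 * 2 * 2) ^ m * ((x ^ 2) ^ m + (y ^ 2) ^ m + (z ^ 2) ^ m) := by
        rw [mul_pow, mul_pow]; ring
    _ = _ := by norm_num

/-- The number of triangles of a random tripartite graph. -/
def tripartiteCount (eX : α × β → ι) (eY : β × γ → ι) (eZ : α × γ → ι) (ω : ι → Bool) : ℝ :=
  ∑ a, ∑ b, ∑ c, coordInd (eX (a, b)) ω * coordInd (eY (b, c)) ω * coordInd (eZ (a, c)) ω

omit [Fintype ι] [DecidableEq ι] [DecidableEq α] [DecidableEq β] [DecidableEq γ] in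
theorem tripartiteCount_sub_eq (hX : ∀ u, p (eX u) = q) (hY : ∀ u, p (eY u) = q)
    (hZ : ∀ u, p (eZ u) = q) (ω : ι → Bool) :
    tripartiteCount eX eY eZ ω -
        q ^ 3 * (Fintype.card α * Fintype.card β * Fintype.card γ) =
      (∑ u : α × γ, (∑ b, coordInd (eX (u.1, b)) ω * coordInd (eY (b, u.2)) ω) *
          coordCentred p (eZ u) ω) +
        (∑ u : β × γ, (q * ∑ a, coordInd (eX (a, u.1)) ω) * coordCentred p (eY u) ω) +
        ∑ u : α × β, (q ^ 2 * Fintype.card γ) * coordCentred p (eX u) ω := by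
  have h1 : ∑ u : α × γ, (∑ b, coordInd (eX (u.1, b)) ω * coordInd (eY (b, u.2)) ω) *
      coordCentred p (eZ u) ω = ∑ a, ∑ b, ∑ c,
        coordInd (eX (a, b)) ω * coordInd (eY (b, c)) ω * (coordInd (eZ (a, c)) ω - q) := by
    rw [Fintype.sum_prod_type]
    refine Finset.sum_congr rfl fun a _ => ?_
    rw [Finset.sum_comm]
    simp only [Finset.sum_mul, coordCentred, hZ]
  have h2 : ∑ u : β × γ, (q * ∑ a, coordInd (eX (a, u.1)) ω) * coordCentred p (eY u) ω =
      ∑ a, ∑ b, ∑ c, q * coordInd (eX (a, b)) ω * (coordInd (eY (b, c)) ω - q) := by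
    rw [Fintype.sum_prod_type, Finset.sum_comm (γ := α)]
    refine Finset.sum_congr rfl fun b _ => ?_
    rw [Finset.sum_comm]
    simp only [Finset.mul_sum, Finset.sum_mul, coordCentred, hY]
  have h3 : ∑ u : α × β, (q ^ 2 * Fintype.card γ) * coordCentred p (eX u) ω =
      ∑ a, ∑ b, ∑ _c : γ, q ^ 2 * (coordInd (eX (a, b)) ω - q) := by
    rw [Fintype.sum_prod_type]
    simp only [coordCentred, hX, Finset.sum_const, Finset.card_univ, nsmul_eq_mul]
    exact Finset.sum_congr rfl fun a _ => Finset.sum_congr rfl fun b _ => by ring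
  have h4 : q ^ 3 * ((Fintype.card α : ℝ) * Fintype.card β * Fintype.card γ) =
      ∑ _a : α, ∑ _b : β, ∑ _c : γ, q ^ 3 := by
    simp
    ring
  rw [h1, h2, h3, h4, tripartiteCount]
  simp only [← Finset.sum_add_distrib, ← Finset.sum_sub_distrib]
  exact Finset.sum_congr rfl fun a _ => Finset.sum_congr rfl fun b _ =>
    Finset.sum_congr rfl fun c _ => by ring

theorem bernoulliExpect_codegree_pow_le (hp : ∀ i, p i ∈ Set.Icc (0 : ℝ) 1) (hn : 1 ≤ n)
    (heX : Function.Injective eX) (heY : Function.Injective eY) (hXY : ∀ u v, eX u ≠ eY v)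
    (hX : ∀ u, p (eX u) = q) (hY : ∀ u, p (eY u) = q) (hq : q ^ 2 ≤ 1)
    (hα : Fintype.card α ≤ n) (hβ : Fintype.card β ≤ n) (hγ : Fintype.card γ ≤ n)
    (hm : m ≠ 0) :
    bernoulliExpect p (fun ω => (2 * m * ∑ u : α × γ,
        (∑ b, coordInd (eX (u.1, b)) ω * coordInd (eY (b, u.2)) ω) ^ 2) ^ m) ≤
      (3932160 * momentScale n q m) ^ m := by
  have hγ' : (Fintype.card γ : ℝ) ≤ n := by exact_mod_cast hγ
  set V := momentScale n q m with hV
  have hV0 : 0 ≤ V := momentScale_nonneg n q m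
  set U : (ι → Bool) → ℝ := fun ω => ∑ a, ∑ c,
    (∑ b, coordInd (eX (a, b)) ω * coordCentred p (eY (b, c)) ω) ^ 2 with hU
  set W : (ι → Bool) → ℝ := fun ω => ∑ a, (∑ b, coordInd (eX (a, b)) ω) ^ 2 with hW
  have hU0 : ∀ ω, 0 ≤ U ω := fun ω => by positivity
  have hW0 : ∀ ω, 0 ≤ W ω := fun ω => by positivity
  have hUm : bernoulliExpect p (fun ω => U ω ^ m) ≤
      (245760 * (n ^ 3 + m * n + m * (q ^ 2 * n ^ 2) + m ^ 2)) ^ m :=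
    bernoulliExpect_mul_centred_pow_le hp hn heX heY hXY hX hα hβ hγ hm
  have hWm : bernoulliExpect p (fun ω => W ω ^ m) ≤
      (64 * (n ^ 2 + m * n + q ^ 2 * n ^ 3)) ^ m :=
    bernoulliExpect_sum_degree_sq_pow_le (e := fun u : β × α => eX u.swap) hp
      (heX.comp Prod.swap_injective) (fun u => hX _) hβ hα hm
  have hle : ∀ ω, ∑ u : α × γ,
      (∑ b, coordInd (eX (u.1, b)) ω * coordInd (eY (b, u.2)) ω) ^ 2 ≤
        2 * U ω + 2 * (q ^ 2 * n) * W ω := by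
    intro ω
    calc _ ≤ ∑ a, ∑ c : γ, (2 * (∑ b, coordInd (eX (a, b)) ω *
          coordCentred p (eY (b, c)) ω) ^ 2 + 2 * (q * ∑ b, coordInd (eX (a, b)) ω) ^ 2) := by
          rw [Fintype.sum_prod_type]
          refine Finset.sum_le_sum fun a _ => Finset.sum_le_sum fun c _ => ?_
          have : ∑ b, coordInd (eX (a, b)) ω * coordInd (eY (b, c)) ω =
              ∑ b, coordInd (eX (a, b)) ω * coordCentred p (eY (b, c)) ω +
                q * ∑ b, coordInd (eX (a, b)) ω := by
            rw [Finset.mul_sum, ← Finset.sum_add_distrib]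
            refine Finset.sum_congr rfl fun b _ => ?_
            rw [coordInd_eq p (eY (b, c)), hY]
            ring
          rw [this]
          exact add_sq_le_two_mul _ _
      _ = 2 * U ω + 2 * (q ^ 2 * Fintype.card γ) * W ω := by
          simp only [hU, hW, Finset.sum_add_distrib, Finset.sum_const, Finset.card_univ,
            nsmul_eq_mul, ← Finset.mul_sum, mul_pow q]
          ring
      _ ≤ _ := by
          have := hW0 ω
          gcongr
  have h1 : 4 * (m : ℝ) * (245760 * (n ^ 3 + m * n + m * (q ^ 2 * n ^ 2) + m ^ 2)) ≤
      983040 * V := by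
    have : 0 ≤ (m : ℝ) * (q ^ 4 * n ^ 4) := by positivity
    rw [hV, momentScale]
    linarith
  have h2 : 4 * (m : ℝ) * (q ^ 2 * n) * (64 * (n ^ 2 + m * n + q ^ 2 * n ^ 3)) ≤
      983040 * V := by
    have h3 : (m : ℝ) * (q ^ 2 * n ^ 3) ≤ m * (1 * n ^ 3) := by gcongr
    have h4 : 0 ≤ (m : ℝ) * n ^ 3 := by positivity
    have h5 : 0 ≤ (m : ℝ) * (q ^ 4 * n ^ 4) := by positivity
    have h6 : 0 ≤ (m : ℝ) ^ 2 * n := by positivity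
    have h7 : 0 ≤ (m : ℝ) ^ 2 * (q ^ 2 * n ^ 2) := by positivity
    have h8 : 0 ≤ (m : ℝ) ^ 3 := by positivity
    rw [hV, momentScale]
    linarith
  calc _ ≤ bernoulliExpect p (fun ω => 2 ^ m * ((4 * m) ^ m * U ω ^ m +
          (4 * m * (q ^ 2 * n)) ^ m * W ω ^ m)) := by
        refine bernoulliExpect_mono hp fun ω => ?_
        have := hU0 ω
        have := hW0 ω
        rw [← mul_pow, ← mul_pow]
        refine le_trans (pow_le_pow_left₀ (by positivity) ?_ m)
          (add_pow_le_two_pow_mul (by positivity) (by positivity) m)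
        have := mul_le_mul_of_nonneg_left (hle ω) (by positivity : (0 : ℝ) ≤ 2 * m)
        linarith
    _ = 2 ^ m * ((4 * m) ^ m * bernoulliExpect p (fun ω => U ω ^ m) +
          (4 * m * (q ^ 2 * n)) ^ m * bernoulliExpect p (fun ω => W ω ^ m)) := by
        rw [bernoulliExpect_const_mul, bernoulliExpect_add, bernoulliExpect_const_mul,
          bernoulliExpect_const_mul]
    _ ≤ 2 ^ m * ((983040 * V) ^ m + (983040 * V) ^ m) := by
        refine mul_le_mul_of_nonneg_left (add_le_add ?_ ?_) (by positivity)
        · refine (mul_le_mul_of_nonneg_left hUm (by positivity)).trans ?_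
          rw [← mul_pow]
          exact pow_le_pow_left₀ (by positivity) h1 m
        · refine (mul_le_mul_of_nonneg_left hWm (by positivity)).trans ?_
          rw [← mul_pow]
          exact pow_le_pow_left₀ (by positivity) h2 m
    _ = 2 * (1966080 * V) ^ m := by
        rw [show 1966080 * V = 2 * (983040 * V) by ring, mul_pow 2]
        ring
    _ ≤ (2 * (1966080 * V)) ^ m := mul_pow_le_mul_pow one_le_two (by positivity) hm
    _ = _ := by ring

/-- Moments of the number of triangles of a random tripartite graph. -/
theorem bernoulliExpect_tripartiteCount_pow_le (hp : ∀ i, p i ∈ Set.Icc (0 : ℝ) 1)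
    (hn : 1 ≤ n) (heX : Function.Injective eX) (heY : Function.Injective eY)
    (heZ : Function.Injective eZ) (hXY : ∀ u v, eX u ≠ eY v) (hXZ : ∀ u v, eX u ≠ eZ v)
    (hYZ : ∀ u v, eY u ≠ eZ v) (hX : ∀ u, p (eX u) = q) (hY : ∀ u, p (eY u) = q)
    (hZ : ∀ u, p (eZ u) = q) (hq : q ^ 2 ≤ 1)
    (hα : Fintype.card α ≤ n) (hβ : Fintype.card β ≤ n) (hγ : Fintype.card γ ≤ n)
    (hm : m ≠ 0) :
    bernoulliExpect p (fun ω => (tripartiteCount eX eY eZ ω -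
        q ^ 3 * (Fintype.card α * Fintype.card β * Fintype.card γ)) ^ (2 * m)) ≤
      (141557760 * momentScale n q m) ^ m := by
  have hα' : (Fintype.card α : ℝ) ≤ n := by exact_mod_cast hα
  have hβ' : (Fintype.card β : ℝ) ≤ n := by exact_mod_cast hβ
  have hγ' : (Fintype.card γ : ℝ) ≤ n := by exact_mod_cast hγ
  have hV0 : 0 ≤ momentScale n q m := momentScale_nonneg n q m
  have h3 : (m : ℝ) * (q ^ 2 * n ^ 3) ≤ m * (1 * n ^ 3) := by gcongr
  have h4 : 0 ≤ (m : ℝ) * n ^ 3 := by positivity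
  have h5 : 0 ≤ (m : ℝ) * (q ^ 4 * n ^ 4) := by positivity
  have h6 : 0 ≤ (m : ℝ) ^ 2 * n := by positivity
  have h7 : 0 ≤ (m : ℝ) ^ 2 * (q ^ 2 * n ^ 2) := by positivity
  have h8 : 0 ≤ (m : ℝ) ^ 3 := by positivity
  have hF1 : bernoulliExpect p (fun ω => (∑ u : α × γ,
      (∑ b, coordInd (eX (u.1, b)) ω * coordInd (eY (b, u.2)) ω) *
        coordCentred p (eZ u) ω) ^ (2 * m)) ≤ (3932160 * momentScale n q m) ^ m := by
    have h := bernoulliExpect_linear_pow_le hp heZ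
      (fun (u : α × γ) ω => ∑ b, coordInd (eX (u.1, b)) ω * coordInd (eY (b, u.2)) ω)
      (fun u v c ω => by
        simp only [coordInd_update_of_ne (hXZ _ v), coordInd_update_of_ne (hYZ _ v)])
      m (fun _ => 1) (fun _ => zero_le_one) (fun _ _ _ => rfl)
    simp only [one_mul] at h
    exact h.trans (bernoulliExpect_codegree_pow_le hp hn heX heY hXY hX hY hq hα hβ hγ hm)
  have hF2 : bernoulliExpect p (fun ω => (∑ u : β × γ,
      (q * ∑ a, coordInd (eX (a, u.1)) ω) * coordCentred p (eY u) ω) ^ (2 * m)) ≤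
        (3932160 * momentScale n q m) ^ m := by
    have h := bernoulliExpect_linear_pow_le hp heY
      (fun (u : β × γ) ω => q * ∑ a, coordInd (eX (a, u.1)) ω)
      (fun u v c ω => by simp only [coordInd_update_of_ne (hXY _ v)])
      m (fun _ => 1) (fun _ => zero_le_one) (fun _ _ _ => rfl)
    simp only [one_mul] at h
    refine h.trans ?_
    calc _ ≤ bernoulliExpect p (fun ω => (2 * m * (q ^ 2 * n)) ^ m *
          (∑ b, (∑ a, coordInd (eX (a, b)) ω) ^ 2) ^ m) := by
          refine bernoulliExpect_mono hp fun ω => ?_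
          rw [← mul_pow, mul_assoc (2 * (m : ℝ))]
          refine pow_le_pow_left₀ (by positivity)
            (mul_le_mul_of_nonneg_left ?_ (by positivity)) m
          have : ∑ u : β × γ, (q * ∑ a, coordInd (eX (a, u.1)) ω) ^ 2 =
              q ^ 2 * Fintype.card γ * ∑ b, (∑ a, coordInd (eX (a, b)) ω) ^ 2 := by
            rw [Fintype.sum_prod_type, Finset.mul_sum]
            simp only [Finset.sum_const, Finset.card_univ, nsmul_eq_mul]
            exact Finset.sum_congr rfl fun b _ => by ring
          rw [this]
          gcongr
      _ ≤ (2 * m * (q ^ 2 * n)) ^ m * (64 * (n ^ 2 + m * n + q ^ 2 * n ^ 3)) ^ m := by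
          rw [bernoulliExpect_const_mul]
          gcongr
          exact bernoulliExpect_sum_degree_sq_pow_le hp heX hX hα hβ hm
      _ ≤ _ := by
          rw [← mul_pow]
          refine pow_le_pow_left₀ (by positivity) ?_ m
          rw [momentScale]
          linarith
  have hF3 : bernoulliExpect p (fun ω => (∑ u : α × β,
      (q ^ 2 * Fintype.card γ) * coordCentred p (eX u) ω) ^ (2 * m)) ≤
        (3932160 * momentScale n q m) ^ m := by
    have h := bernoulliExpect_linear_pow_le hp heX
      (fun (_ : α × β) _ => q ^ 2 * (Fintype.card γ : ℝ))
      (fun _ _ _ _ => rfl) m (fun _ => 1) (fun _ => zero_le_one) (fun _ _ _ => rfl)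
    simp only [one_mul, bernoulliExpect_const] at h
    refine h.trans (pow_le_pow_left₀ (by positivity) ?_ m)
    calc _ = 2 * m * (Fintype.card α * Fintype.card β *
          (q ^ 4 * (Fintype.card γ : ℝ) ^ 2)) := by
          simp only [Finset.sum_const, Finset.card_univ, Fintype.card_prod, nsmul_eq_mul]
          push_cast
          ring
      _ ≤ 2 * m * (n * n * (q ^ 4 * n ^ 2)) := by gcongr
      _ ≤ _ := by
          rw [momentScale]
          linarith
  calc _ ≤ bernoulliExpect p (fun ω => 12 ^ m * ((∑ u : α × γ,
            (∑ b, coordInd (eX (u.1, b)) ω * coordInd (eY (b, u.2)) ω) *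
              coordCentred p (eZ u) ω) ^ (2 * m) +
          (∑ u : β × γ, (q * ∑ a, coordInd (eX (a, u.1)) ω) *
            coordCentred p (eY u) ω) ^ (2 * m) +
          (∑ u : α × β, (q ^ 2 * Fintype.card γ) * coordCentred p (eX u) ω) ^ (2 * m))) := by
        refine bernoulliExpect_mono hp fun ω => ?_
        rw [tripartiteCount_sub_eq hX hY hZ]
        exact add_add_pow_two_mul_le _ _ _ m
    _ ≤ 12 ^ m * ((3932160 * momentScale n q m) ^ m + (3932160 * momentScale n q m) ^ m +
          (3932160 * momentScale n q m) ^ m) := by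
        rw [bernoulliExpect_const_mul, bernoulliExpect_add, bernoulliExpect_add]
        gcongr
    _ = 3 * (47185920 * momentScale n q m) ^ m := by
        rw [show 47185920 * momentScale n q m = 12 * (3932160 * momentScale n q m) by ring,
          mul_pow 12]
        ring
    _ ≤ (3 * (47185920 * momentScale n q m)) ^ m :=
        mul_pow_le_mul_pow (by norm_num) (by positivity) hm
    _ = _ := by ring

end TripartiteTriangles

section Decoupling

theorem sum_distinct_eq_six_mul {n : ℕ} (g : Fin n → Fin n → Fin n → ℝ)
    (h1 : ∀ i j k, g i j k = g j i k) (h2 : ∀ i j k, g i j k = g i k j) :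
    (∑ i, ∑ j, ∑ k, if i ≠ j ∧ j ≠ k ∧ i ≠ k then g i j k else 0) =
      6 * ∑ i, ∑ j, ∑ k, if i < j ∧ j < k then g i j k else 0 := by
  set P : Fin n → Fin n → Fin n → ℝ := fun i j k => if i < j ∧ j < k then g i j k else 0 with hP
  have hsplit : ∀ i j k, (if i ≠ j ∧ j ≠ k ∧ i ≠ k then g i j k else 0) =
      P i j k + P i k j + P j i k + P j k i + P k i j + P k j i := by
    intro i j k
    have e1 : g i k j = g i j k := (h2 i j k).symm
    have e2 : g j i k = g i j k := (h1 i j k).symm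
    have e3 : g j k i = g i j k := by rw [h2 j k i, e2]
    have e4 : g k i j = g i j k := by rw [h1 k i j, e1]
    have e5 : g k j i = g i j k := by rw [h2 k j i, e4]
    simp only [hP, e1, e2, e3, e4, e5]
    rcases lt_trichotomy i j with h | h | h <;> rcases lt_trichotomy j k with h' | h' | h' <;>
      rcases lt_trichotomy i k with h'' | h'' | h'' <;>
      first
      | (exfalso; omega)
      | simp [h, h', h'', h.ne, h'.ne, h''.ne, h.ne', h'.ne', h''.ne', h.not_gt, h'.not_gt,
          h''.not_gt]
      | (subst h; simp [h'.not_gt])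
      | (subst h'; simp [h''.not_gt])
      | (subst h''; simp [h'.not_gt])
  have s1 : ∀ F : Fin n → Fin n → Fin n → ℝ,
      ∑ i, ∑ j, ∑ k, F i k j = ∑ i, ∑ j, ∑ k, F i j k :=
    fun F => Finset.sum_congr rfl fun i _ => Finset.sum_comm
  have s2 : ∀ F : Fin n → Fin n → Fin n → ℝ,
      ∑ i, ∑ j, ∑ k, F j i k = ∑ i, ∑ j, ∑ k, F i j k := fun F => Finset.sum_comm
  simp only [hsplit, Finset.sum_add_distrib]
  rw [s1 P, s2 P, (s1 fun i j k => P j i k).trans (s2 P),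
    (s2 fun i j k => P i k j).trans (s1 P),
    (s1 fun i j k => P j k i).trans ((s2 fun i j k => P i k j).trans (s1 P))]
  change _ = 6 * ∑ i, ∑ j, ∑ k, P i j k
  ring

theorem card_colorings {n : ℕ} {i j k : Fin n} (hij : i ≠ j) (hjk : j ≠ k) (hik : i ≠ k) :
    27 * #{δ : Fin n → Fin 3 | δ i = 0 ∧ δ j = 1 ∧ δ k = 2} = 3 ^ n := by
  have h : ({δ : Fin n → Fin 3 | δ i = 0 ∧ δ j = 1 ∧ δ k = 2} : Finset _) =
      Fintype.piFinset fun l => if l = i then {0} else if l = j then {1} else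
        if l = k then {2} else univ := by
    ext δ
    simp only [mem_filter, mem_univ, true_and, Fintype.mem_piFinset]
    constructor
    · rintro ⟨hi, hj, hk⟩ l
      split_ifs <;> simp_all
    · intro h
      refine ⟨by simpa using h i, by simpa [hij.symm] using h j,
        by simpa [hik.symm, hjk.symm] using h k⟩
  rw [h, Fintype.card_piFinset, ← Finset.mul_prod_erase univ _ (mem_univ i),
    ← Finset.mul_prod_erase (univ.erase i) _ (Finset.mem_erase.2 ⟨hij.symm, mem_univ j⟩),
    ← Finset.mul_prod_erase ((univ.erase i).erase j) _
      (Finset.mem_erase.2 ⟨hjk.symm, Finset.mem_erase.2 ⟨hik.symm, mem_univ k⟩⟩)]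
  rw [Finset.prod_congr rfl (g := fun _ => 3) (fun l hl => by
    simp only [Finset.mem_erase, mem_univ, and_true] at hl
    simp [hl.1, hl.2.1, hl.2.2])]
  have hc : #(((univ.erase i).erase j).erase k) + 3 = n := by
    have hk : k ∈ (univ.erase i).erase j := by simp [hjk.symm, hik.symm]
    have hj : j ∈ (univ : Finset (Fin n)).erase i := by simp [hij.symm]
    have h1 := Finset.card_erase_add_one hk
    have h2 := Finset.card_erase_add_one hj
    have h3 := Finset.card_erase_add_one (mem_univ i)
    rw [Finset.card_univ, Fintype.card_fin] at h3
    omega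
  rw [Finset.prod_const]
  conv_rhs => rw [← hc, pow_add]
  simp [hij.symm, hik.symm, hjk.symm]
  ring

variable {n : ℕ}

/-- The number of triangles of the random graph with edge set `ω`. -/
def triangleSum (ω : Sym2 (Fin n) → Bool) : ℝ :=
  ∑ i, ∑ j, ∑ k, if i < j ∧ j < k then
    coordInd s(i, j) ω * coordInd s(j, k) ω * coordInd s(i, k) ω else 0

/-- The edges between the colour classes `c` and `c'` of the colouring `δ`. -/
def colorEdge (δ : Fin n → Fin 3) (c c' : Fin 3)
    (u : {i // δ i = c} × {i // δ i = c'}) : Sym2 (Fin n) := s(u.1.1, u.2.1)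

theorem colorEdge_injective (δ : Fin n → Fin 3) {c c' : Fin 3} (h : c ≠ c') :
    Function.Injective (colorEdge δ c c') := by
  rintro ⟨⟨a, ha⟩, ⟨b, hb⟩⟩ ⟨⟨a', ha'⟩, ⟨b', hb'⟩⟩ he
  simp only [colorEdge, Sym2.eq_iff] at he
  rcases he with ⟨rfl, rfl⟩ | ⟨rfl, rfl⟩
  · rfl
  · exact absurd (ha.symm.trans hb') h

/-- The triangles with vertices coloured `0`, `1` and `2`. -/
def colorTriangleSum (δ : Fin n → Fin 3) (ω : Sym2 (Fin n) → Bool) : ℝ :=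
  tripartiteCount (colorEdge δ 0 1) (colorEdge δ 1 2) (colorEdge δ 0 2) ω

theorem sum_colorTriangleSum (ω : Sym2 (Fin n) → Bool) :
    27 * ∑ δ : Fin n → Fin 3, colorTriangleSum δ ω = 3 ^ n * (6 * triangleSum ω) := by
  set g : Fin n → Fin n → Fin n → ℝ := fun i j k =>
    coordInd s(i, j) ω * coordInd s(j, k) ω * coordInd s(i, k) ω with hg
  have h1 : ∀ δ : Fin n → Fin 3, colorTriangleSum δ ω =
      ∑ i, ∑ j, ∑ k, if δ i = 0 ∧ δ j = 1 ∧ δ k = 2 then g i j k else 0 := by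
    intro δ
    have hs : ∀ (c : Fin 3) (F : Fin n → ℝ),
        ∑ i : {i // δ i = c}, F i = ∑ i, if δ i = c then F i else 0 := by
      intro c F
      rw [← Finset.sum_filter, ← Finset.sum_subtype_eq_sum_filter]
      exact Finset.sum_congr (by ext; simp) fun _ _ => rfl
    simp only [colorTriangleSum, tripartiteCount, colorEdge]
    rw [hs 0 fun i => ∑ b : {i // δ i = 1}, ∑ c : {i // δ i = 2}, g i b c]
    refine Finset.sum_congr rfl fun i _ => ?_
    rw [hs 1 fun j => ∑ c : {i // δ i = 2}, g i j c]
    by_cases hi : δ i = 0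
    · simp only [hi, if_true, true_and]
      refine Finset.sum_congr rfl fun j _ => ?_
      rw [hs 2 fun k => g i j k]
      by_cases hj : δ j = 1 <;> simp [hj]
    · simp [hi]
  have h2 : ∀ i j k, 27 * ∑ δ : Fin n → Fin 3,
      (if δ i = 0 ∧ δ j = 1 ∧ δ k = 2 then g i j k else 0) =
        3 ^ n * (if i ≠ j ∧ j ≠ k ∧ i ≠ k then g i j k else 0) := by
    intro i j k
    rw [← Finset.sum_filter, Finset.sum_const, nsmul_eq_mul]
    split_ifs with h
    · have := card_colorings h.1 h.2.1 h.2.2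
      rw [← mul_assoc]
      congr 1
      exact_mod_cast this
    · have : ({δ : Fin n → Fin 3 | δ i = 0 ∧ δ j = 1 ∧ δ k = 2} : Finset _) = ∅ := by
        refine Finset.filter_eq_empty_iff.2 fun δ _ hδ => h ⟨?_, ?_, ?_⟩ <;> rintro rfl
        · exact absurd (hδ.1.symm.trans hδ.2.1) (by decide)
        · exact absurd (hδ.2.1.symm.trans hδ.2.2) (by decide)
        · exact absurd (hδ.1.symm.trans hδ.2.2) (by decide)
      rw [this]
      simp
  have h3 := sum_distinct_eq_six_mul g
    (fun i j k => by simp only [hg]; rw [Sym2.eq_swap (a := j) (b := i)]; ring)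
    (fun i j k => by simp only [hg]; rw [Sym2.eq_swap (a := k) (b := j)]; ring)
  rw [triangleSum, ← h3]
  simp only [Finset.mul_sum, ← h2]
  simp only [h1, Finset.mul_sum]
  rw [Finset.sum_comm]
  refine Finset.sum_congr rfl fun i _ => ?_
  rw [Finset.sum_comm]
  refine Finset.sum_congr rfl fun j _ => ?_
  rw [Finset.sum_comm]

/-- The edge probabilities: `q`, and `1 / 2` for the irrelevant diagonal entries. -/
def edgeProb (q : ℝ) (e : Sym2 (Fin n)) : ℝ := if e.IsDiag then 1 / 2 else q

theorem edgeProb_mem {q : ℝ} (hq : q ∈ Set.Icc (0 : ℝ) 1) (e : Sym2 (Fin n)) :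
    edgeProb q e ∈ Set.Icc (0 : ℝ) 1 := by
  unfold edgeProb
  split_ifs
  · norm_num
  · exact hq

theorem edgeProb_colorEdge (q : ℝ) (δ : Fin n → Fin 3) {c c' : Fin 3} (h : c ≠ c')
    (u : {i // δ i = c} × {i // δ i = c'}) : edgeProb q (colorEdge δ c c' u) = q := by
  obtain ⟨⟨a, ha⟩, ⟨b, hb⟩⟩ := u
  rw [edgeProb, if_neg]
  rw [colorEdge, Sym2.mk_isDiag_iff]
  intro hab
  exact h (ha.symm.trans ((congrArg δ hab).trans hb))

theorem bernoulliExpect_colorTriangleSum_pow_le {q : ℝ} (hq : q ∈ Set.Icc (0 : ℝ) 1)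
    (hn : 1 ≤ n) (δ : Fin n → Fin 3) {m : ℕ} (hm : m ≠ 0) :
    bernoulliExpect (edgeProb q) (fun ω => (colorTriangleSum δ ω - q ^ 3 *
        (Fintype.card {i // δ i = 0} * Fintype.card {i // δ i = 1} *
          Fintype.card {i // δ i = 2})) ^ (2 * m)) ≤
      (141557760 * momentScale n q m) ^ m := by
  have hc : ∀ c, Fintype.card {i // δ i = c} ≤ n := fun c => by
    simpa using Fintype.card_subtype_le fun i => δ i = c
  refine bernoulliExpect_tripartiteCount_pow_le (edgeProb_mem hq) hn
    (colorEdge_injective δ (by decide)) (colorEdge_injective δ (by decide))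
    (colorEdge_injective δ (by decide)) ?_ ?_ ?_ (edgeProb_colorEdge q δ (by decide))
    (edgeProb_colorEdge q δ (by decide)) (edgeProb_colorEdge q δ (by decide))
    (pow_le_one₀ hq.1 hq.2) (hc 0) (hc 1) (hc 2) hm
  all_goals
    rintro ⟨⟨a, ha⟩, ⟨b, hb⟩⟩ ⟨⟨a', ha'⟩, ⟨b', hb'⟩⟩ he
    simp only [colorEdge, Sym2.eq_iff] at he
    rcases he with ⟨rfl, rfl⟩ | ⟨rfl, rfl⟩ <;> simp_all

/-- Moments of the number of triangles in the binomial random graph. -/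
theorem exists_bernoulliExpect_triangleSum_pow_le {q : ℝ} (hq : q ∈ Set.Icc (0 : ℝ) 1)
    (hn : 1 ≤ n) {m : ℕ} (hm : m ≠ 0) : ∃ μ : ℝ,
    bernoulliExpect (edgeProb q) (fun ω : Sym2 (Fin n) → Bool =>
        (triangleSum ω - μ) ^ (2 * m)) ≤ (2866544640 * momentScale n q m) ^ m := by
  set κ : (Fin n → Fin 3) → ℝ := fun δ => q ^ 3 *
    (Fintype.card {i // δ i = 0} * Fintype.card {i // δ i = 1} *
      Fintype.card {i // δ i = 2}) with hκ
  have h3 : (0 : ℝ) < 3 ^ n := by positivity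
  have hw : ∑ _δ : Fin n → Fin 3, ((3 : ℝ) ^ n)⁻¹ = 1 := by simp
  refine ⟨9 / 2 * ∑ δ, ((3 : ℝ) ^ n)⁻¹ * κ δ, ?_⟩
  have heq : ∀ ω : Sym2 (Fin n) → Bool,
      triangleSum ω - 9 / 2 * ∑ δ, ((3 : ℝ) ^ n)⁻¹ * κ δ =
        9 / 2 * ∑ δ, ((3 : ℝ) ^ n)⁻¹ * (colorTriangleSum δ ω - κ δ) := by
    intro ω
    have h := sum_colorTriangleSum ω
    simp only [mul_sub, Finset.sum_sub_distrib]
    congr 1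
    rw [← Finset.mul_sum]
    field_simp
    linarith
  calc _ ≤ bernoulliExpect (edgeProb q) (fun ω : Sym2 (Fin n) → Bool => (9 / 2) ^ (2 * m) *
        ∑ δ, ((3 : ℝ) ^ n)⁻¹ * (colorTriangleSum δ ω - κ δ) ^ (2 * m)) := by
        refine bernoulliExpect_mono (edgeProb_mem hq) fun ω => ?_
        rw [heq, mul_pow]
        exact mul_le_mul_of_nonneg_left (Real.pow_arith_mean_le_arith_mean_pow_of_even _ _ _
          (fun _ _ => by positivity) hw (even_two_mul m)) (by positivity)
    _ = (9 / 2) ^ (2 * m) * ∑ δ, ((3 : ℝ) ^ n)⁻¹ * bernoulliExpect (edgeProb q)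
          (fun ω => (colorTriangleSum δ ω - κ δ) ^ (2 * m)) := by
        simp only [bernoulliExpect_const_mul, bernoulliExpect_sum]
    _ ≤ (9 / 2) ^ (2 * m) * ∑ _δ : Fin n → Fin 3, ((3 : ℝ) ^ n)⁻¹ *
          (141557760 * momentScale n q m) ^ m := by
        gcongr with δ
        exact bernoulliExpect_colorTriangleSum_pow_le hq hn δ hm
    _ = _ := by
        rw [← Finset.sum_mul, hw, one_mul, pow_mul, ← mul_pow]
        ring

end Decoupling

section Levels

variable {ι : Type*} [Fintype ι] [DecidableEq ι]

/-- The number of coordinates in `A` that are switched on. -/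
def levelCount (A : Finset ι) (ω : ι → Bool) : ℕ := #{e ∈ A | ω e = true}

/-- The configurations with exactly `m` coordinates in `A` switched on. -/
def level (A : Finset ι) (m : ℕ) : Finset (ι → Bool) := {ω | levelCount A ω = m}

theorem mem_level {A : Finset ι} {m : ℕ} {ω : ι → Bool} :
    ω ∈ level A m ↔ levelCount A ω = m := by simp [level]

omit [Fintype ι] in
theorem levelCount_update_true {A : Finset ι} {e : ι} (he : e ∈ A) {ω : ι → Bool}
    (h : ω e = false) : levelCount A (Function.update ω e true) = levelCount A ω + 1 := by
  have : ({e' ∈ A | Function.update ω e true e' = true} : Finset ι) =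
      insert e {e' ∈ A | ω e' = true} := by
    ext e'
    by_cases h' : e' = e
    · subst h'; simp [he]
    · simp [h']
  rw [levelCount, this, Finset.card_insert_of_notMem (by simp [h]), levelCount]

omit [Fintype ι] [DecidableEq ι] in
theorem card_filter_false (A : Finset ι) (ω : ι → Bool) :
    (#{e ∈ A | ω e = false} : ℝ) = #A - levelCount A ω := by
  have h := Finset.card_filter_add_card_filter_not (s := A) (fun e => ω e = true)
  simp only [Bool.not_eq_true] at h
  rw [levelCount, ← h]
  push_cast
  ring

theorem sum_level_sum_update (A : Finset ι) (m : ℕ) (F : (ι → Bool) → ℝ) :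
    ∑ ω ∈ level A m, ∑ e ∈ A with ω e = false, F (Function.update ω e true) =
      (m + 1) * ∑ ω ∈ level A (m + 1), F ω := by
  have h1 : (m + 1) * ∑ ω ∈ level A (m + 1), F ω =
      ∑ ω ∈ level A (m + 1), ∑ e ∈ A with ω e = true, F ω := by
    rw [Finset.mul_sum]
    refine Finset.sum_congr rfl fun ω hω => ?_
    rw [Finset.sum_const, nsmul_eq_mul]
    rw [mem_level, levelCount] at hω
    rw [hω]
    push_cast
    ring
  rw [h1]
  simp only [Finset.sum_filter]
  rw [Finset.sum_comm, Finset.sum_comm (s := level A (m + 1))]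
  refine Finset.sum_congr rfl fun e he => ?_
  rw [← Finset.sum_filter, ← Finset.sum_filter]
  refine Finset.sum_nbij' (fun ω => Function.update ω e true)
    (fun ω => Function.update ω e false) ?_ ?_ ?_ ?_ ?_
  · intro ω hω
    rw [Finset.mem_filter, mem_level] at hω ⊢
    exact ⟨by rw [levelCount_update_true he hω.2, hω.1], by simp⟩
  · intro ω hω
    rw [Finset.mem_filter, mem_level] at hω ⊢
    refine ⟨?_, by simp⟩
    have h := levelCount_update_true he (ω := Function.update ω e false) (by simp)
    rw [Function.update_idem, ← hω.2, Function.update_eq_self] at h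
    omega
  · intro ω hω
    rw [Finset.mem_filter] at hω
    simp [← hω.2]
  · intro ω hω
    rw [Finset.mem_filter] at hω
    simp [← hω.2]
  · intro ω hω
    rfl

omit [Fintype ι] in
theorem le_update_true (ω : ι → Bool) (e : ι) : ω ≤ Function.update ω e true :=
  le_update_self_iff.2 (Bool.le_true _)

theorem card_mul_sum_level_le_succ (A : Finset ι) (m : ℕ) {F : (ι → Bool) → ℝ}
    (hF : Monotone F) :
    #(level A (m + 1)) * ∑ ω ∈ level A m, F ω ≤
      #(level A m) * ∑ ω ∈ level A (m + 1), F ω := by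
  have h0 := sum_level_sum_update A m fun _ => 1
  have h1 := sum_level_sum_update A m F
  have hc : ∀ ω ∈ level A m, (#{e ∈ A | ω e = false} : ℝ) = #A - m := fun ω hω => by
    rw [card_filter_false, mem_level.1 hω]
  have h2 : (#A - m : ℝ) * ∑ ω ∈ level A m, F ω ≤
      (m + 1) * ∑ ω ∈ level A (m + 1), F ω := by
    rw [← h1, Finset.mul_sum]
    refine Finset.sum_le_sum fun ω hω => ?_
    rw [← hc ω hω, ← nsmul_eq_mul, ← Finset.sum_const]
    exact Finset.sum_le_sum fun e _ => hF (le_update_true ω e)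
  have h3 : (#(level A m) : ℝ) * (#A - m) = (m + 1) * #(level A (m + 1)) := by
    simp only [Finset.sum_const, nsmul_eq_mul, mul_one] at h0
    rw [← h0, Finset.sum_congr rfl hc, Finset.sum_const, nsmul_eq_mul]
  have h4 := mul_le_mul_of_nonneg_left h2 (Nat.cast_nonneg (α := ℝ) #(level A m))
  rw [← mul_assoc, h3] at h4
  have h5 : (0 : ℝ) < m + 1 := by positivity
  nlinarith

/-- The average of an increasing function over a level increases with the level. -/
theorem card_mul_sum_level_le (A : Finset ι) {m m' : ℕ} (h : m ≤ m') {F : (ι → Bool) → ℝ}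
    (hF : Monotone F) :
    #(level A m') * ∑ ω ∈ level A m, F ω ≤ #(level A m) * ∑ ω ∈ level A m', F ω := by
  induction m', h using Nat.le_induction with
  | base => exact le_rfl
  | succ k hk ih =>
    have h1 := card_mul_sum_level_le_succ A k hF
    rcases (level A k).eq_empty_or_nonempty with h0 | h0
    · have h2 := sum_level_sum_update A k fun _ => 1
      have h3 : level A (k + 1) = ∅ := by
        rw [h0] at h2
        simp only [Finset.sum_empty, Finset.sum_const, nsmul_eq_mul, mul_one] at h2
        have : (#(level A (k + 1)) : ℝ) = 0 := by
          rcases mul_eq_zero.1 h2.symm with h | h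
          · exact absurd h (by positivity)
          · exact h
        exact Finset.card_eq_zero.1 (by exact_mod_cast this)
      simp [h3]
    · have h2 : (0 : ℝ) < #(level A k) := by exact_mod_cast h0.card_pos
      have h3 := mul_le_mul_of_nonneg_left ih (Nat.cast_nonneg (α := ℝ) #(level A (k + 1)))
      have h4 := mul_le_mul_of_nonneg_left h1 (Nat.cast_nonneg (α := ℝ) #(level A m))
      refine le_of_mul_le_mul_left ?_ h2
      linarith

variable {A : Finset ι} {p : ι → ℝ} {q : ℝ}

theorem prod_bernoulliWeight_eq (hA : ∀ e ∈ A, p e = q) (hA' : ∀ e ∉ A, p e = 1 / 2)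
    (ω : ι → Bool) : ∏ e, bernoulliWeight (p e) (ω e) =
      q ^ levelCount A ω * (1 - q) ^ (#A - levelCount A ω) * (1 / 2) ^ #Aᶜ := by
  rw [← Finset.prod_mul_prod_compl A]
  congr 1
  · rw [Finset.prod_congr rfl (g := fun e => if ω e = true then q else 1 - q)
      (fun e he => by rw [hA e he, bernoulliWeight]), Finset.prod_ite, Finset.prod_const,
      Finset.prod_const]
    have h := Finset.card_filter_add_card_filter_not (s := A) (fun e => ω e = true)
    rw [levelCount]
    congr 2
    omega
  · rw [Finset.prod_congr rfl (g := fun _ => (1 / 2 : ℝ)) (fun e he => by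
      rw [hA' e (Finset.mem_compl.1 he), bernoulliWeight]; split_ifs <;> norm_num),
      Finset.prod_const]

theorem bernoulliExpect_eq_sum_level (hA : ∀ e ∈ A, p e = q) (hA' : ∀ e ∉ A, p e = 1 / 2)
    (F : (ι → Bool) → ℝ) : bernoulliExpect p F = ∑ m ∈ range (#A + 1),
      q ^ m * (1 - q) ^ (#A - m) * (1 / 2) ^ #Aᶜ * ∑ ω ∈ level A m, F ω := by
  rw [bernoulliExpect, ← Finset.sum_fiberwise_of_maps_to (g := levelCount A)
    (t := range (#A + 1)) (fun ω _ => Finset.mem_range_succ_iff.2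
      (Finset.card_filter_le _ _))]
  refine Finset.sum_congr rfl fun m _ => ?_
  rw [Finset.mul_sum, level]
  refine Finset.sum_congr rfl fun ω hω => ?_
  rw [prod_bernoulliWeight_eq hA hA', (Finset.mem_filter.1 hω).2]

/-- Comparison of a level with a set of levels on which the averages of `F` are larger. -/
theorem sum_level_mul_bernoulliExpect_le (hq : q ∈ Set.Icc (0 : ℝ) 1) (hA : ∀ e ∈ A, p e = q)
    (hA' : ∀ e ∉ A, p e = 1 / 2) (M : ℕ) (Q : ℕ → Prop) (F : (ι → Bool) → ℝ)
    (h : ∀ m, Q m → #(level A m) * ∑ ω ∈ level A M, F ω ≤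
      #(level A M) * ∑ ω ∈ level A m, F ω) :
    (∑ ω ∈ level A M, F ω) * bernoulliExpect p (fun ω => if Q (levelCount A ω) then 1 else 0) ≤
      #(level A M) * bernoulliExpect p (fun ω => if Q (levelCount A ω) then F ω else 0) := by
  rw [bernoulliExpect_eq_sum_level hA hA', bernoulliExpect_eq_sum_level hA hA', Finset.mul_sum,
    Finset.mul_sum]
  refine Finset.sum_le_sum fun m _ => ?_
  have hs : ∀ G : (ι → Bool) → ℝ, ∑ ω ∈ level A m, (if Q (levelCount A ω) then G ω else 0) =
      if Q m then ∑ ω ∈ level A m, G ω else 0 := by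
    intro G
    rw [Finset.sum_congr rfl (g := fun ω => if Q m then G ω else 0)
      (fun ω hω => by rw [mem_level.1 hω])]
    split_ifs <;> simp
  rw [hs, hs]
  split_ifs with hm
  · have h0 : 0 ≤ q ^ m * (1 - q) ^ (#A - m) * (1 / 2) ^ #Aᶜ := by
      have := hq.1
      have := sub_nonneg.2 hq.2
      positivity
    have := mul_le_mul_of_nonneg_left (h m hm) h0
    simp only [Finset.sum_const, nsmul_eq_mul, mul_one]
    linarith
  · simp

omit [Fintype ι] [DecidableEq ι] in
/-- The centred number of coordinates in `A` that are switched on. -/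
theorem sum_coordCentred_eq (hA : ∀ e ∈ A, p e = q) (ω : ι → Bool) :
    ∑ e ∈ A, coordCentred p e ω = levelCount A ω - #A * q := by
  rw [Finset.sum_congr rfl (g := fun e => (if ω e = true then 1 else 0) - q)
    (fun e he => by rw [coordCentred, hA e he, coordInd]), Finset.sum_sub_distrib,
    Finset.sum_boole, levelCount]
  simp

theorem bernoulliExpect_sum_coordCentred_mul (hA : ∀ e ∈ A, p e = q)
    (G : (ι → Bool) → ℝ) :
    bernoulliExpect p (fun ω => (∑ e ∈ A, coordCentred p e ω) * G ω) =
      ∑ e ∈ A, q * (1 - q) * bernoulliExpect p (fun ω =>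
        G (Function.update ω e true) - G (Function.update ω e false)) := by
  simp only [Finset.sum_mul]
  rw [bernoulliExpect_sum]
  refine Finset.sum_congr rfl fun e he => ?_
  rw [bernoulliExpect_centred_mul, bernoulliExpect_const_mul, hA e he]

omit [Fintype ι] in
theorem sum_coordCentred_update {e : ι} (he : e ∈ A) (b : Bool) (ω : ι → Bool) :
    ∑ e' ∈ A, coordCentred p e' (Function.update ω e b) =
      ∑ e' ∈ A, coordCentred p e' ω - coordInd e ω + if b then 1 else 0 := by
  rw [← Finset.add_sum_erase A _ he, ← Finset.add_sum_erase A (fun e' => coordCentred p e' ω) he]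
  rw [Finset.sum_congr rfl (g := fun e' => coordCentred p e' ω) (fun e' he' => by
    rw [coordCentred_update, if_neg (Finset.ne_of_mem_erase he')])]
  rw [coordCentred_update, if_pos rfl, coordCentred]
  ring

theorem bernoulliExpect_sum_coordCentred (hA : ∀ e ∈ A, p e = q) :
    bernoulliExpect p (fun ω => ∑ e ∈ A, coordCentred p e ω) = 0 := by
  have h := bernoulliExpect_sum_coordCentred_mul hA fun _ => 1
  simpa [bernoulliExpect_const] using h

theorem bernoulliExpect_sum_coordCentred_sq (hA : ∀ e ∈ A, p e = q) :
    bernoulliExpect p (fun ω => (∑ e ∈ A, coordCentred p e ω) ^ 2) = #A * (q * (1 - q)) := by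
  have h := bernoulliExpect_sum_coordCentred_mul hA fun ω => ∑ e ∈ A, coordCentred p e ω
  simp only [← sq] at h
  rw [h, Finset.sum_congr rfl (g := fun _ => q * (1 - q))]
  · simp
  · intro e he
    simp [sum_coordCentred_update he, bernoulliExpect_const]

theorem bernoulliExpect_sum_coordCentred_pow_four_le (hp : ∀ i, p i ∈ Set.Icc (0 : ℝ) 1)
    (hq : q ∈ Set.Icc (0 : ℝ) 1) (hA : ∀ e ∈ A, p e = q) :
    bernoulliExpect p (fun ω => (∑ e ∈ A, coordCentred p e ω) ^ 4) ≤
      #A * (q * (1 - q)) * (9 / 2 * (#A * (q * (1 - q))) + 5 / 2) := by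
  have h := bernoulliExpect_sum_coordCentred_mul hA fun ω => (∑ e ∈ A, coordCentred p e ω) ^ 3
  simp only [← pow_succ'] at h
  rw [h]
  have hq0 : 0 ≤ q * (1 - q) := mul_nonneg hq.1 (sub_nonneg.2 hq.2)
  calc _ ≤ ∑ e ∈ A, q * (1 - q) * bernoulliExpect p (fun ω =>
        9 / 2 * (∑ e ∈ A, coordCentred p e ω) ^ 2 + 5 / 2) := by
        refine Finset.sum_le_sum fun e he =>
          mul_le_mul_of_nonneg_left (bernoulliExpect_mono hp fun ω => ?_) hq0
        simp only [sum_coordCentred_update he]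
        set S := ∑ e ∈ A, coordCentred p e ω
        unfold coordInd
        simp only [if_true, Bool.false_eq_true, if_false]
        split_ifs
        · nlinarith [sq_nonneg (S + 1)]
        · nlinarith [sq_nonneg (S - 1)]
    _ = _ := by
        rw [bernoulliExpect_add, bernoulliExpect_const_mul, bernoulliExpect_const,
          bernoulliExpect_sum_coordCentred_sq hA, Finset.sum_const, nsmul_eq_mul]
        ring

omit [DecidableEq ι] in
/-- A centred variable with comparable second and fourth moments is nonnegative with
probability bounded from below. -/
theorem one_le_mul_bernoulliExpect_nonneg [DecidableEq ι] (hp : ∀ i, p i ∈ Set.Icc (0 : ℝ) 1)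
    {S : (ι → Bool) → ℝ} {v : ℝ} (h1 : bernoulliExpect p S = 0)
    (h2 : bernoulliExpect p (fun ω => S ω ^ 2) = v)
    (h4 : bernoulliExpect p (fun ω => S ω ^ 4) ≤ v * (9 / 2 * v + 5 / 2))
    (hv : v = 0 ∨ 1 / 2 ≤ v) (hS : ∀ ω, S ω < 0 → 1 ≤ S ω ^ 2) :
    1 ≤ 23 * bernoulliExpect p (fun ω => if 0 ≤ S ω then 1 else 0) := by
  rcases hv with rfl | hv
  · have h : bernoulliExpect p (fun ω => 1 + (-1) * S ω ^ 2) ≤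
        bernoulliExpect p (fun ω => if 0 ≤ S ω then 1 else 0) := by
      refine bernoulliExpect_mono hp fun ω => ?_
      split_ifs with h
      · nlinarith [sq_nonneg (S ω)]
      · linarith [hS ω (not_le.1 h)]
    rw [bernoulliExpect_add, bernoulliExpect_const_mul, h2, bernoulliExpect_const] at h
    linarith
  · have hv0 : 0 < v := by linarith
    set σ := √v
    have hσ : 0 < σ := Real.sqrt_pos.2 hv0
    have hσ2 : σ ^ 2 = v := Real.sq_sqrt hv0.le
    have hpoly : ∀ s : ℝ, 2 * s + s ^ 2 - s ^ 4 / 20 ≤ if 0 ≤ s then 12 else 0 := by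
      intro s
      split_ifs with h
      · nlinarith [sq_nonneg (s ^ 2 - 13), sq_nonneg (s - 7 / 2)]
      · nlinarith [sq_nonneg (s ^ 2 - 9), sq_nonneg (s + 3)]
    have h : bernoulliExpect p (fun ω => 2 / σ * S ω + (1 / v * S ω ^ 2 +
        (-(1 / (20 * v ^ 2))) * S ω ^ 4)) ≤
        bernoulliExpect p (fun ω => 12 * if 0 ≤ S ω then 1 else 0) := by
      refine bernoulliExpect_mono hp fun ω => ?_
      have h := hpoly (S ω / σ)
      have e1 : 2 / σ * S ω + (1 / v * S ω ^ 2 + (-(1 / (20 * v ^ 2))) * S ω ^ 4) =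
          2 * (S ω / σ) + (S ω / σ) ^ 2 - (S ω / σ) ^ 4 / 20 := by
        rw [← hσ2]
        field_simp
        ring
      rw [e1]
      refine h.trans (le_of_eq ?_)
      have : 0 ≤ S ω / σ ↔ 0 ≤ S ω := by
        rw [le_div_iff₀ hσ, zero_mul]
      simp only [this, mul_ite, mul_one, mul_zero]
    rw [bernoulliExpect_add, bernoulliExpect_add, bernoulliExpect_const_mul,
      bernoulliExpect_const_mul, bernoulliExpect_const_mul, bernoulliExpect_const_mul, h1, h2]
      at h
    have h5 : 1 / (20 * v ^ 2) * bernoulliExpect p (fun ω => S ω ^ 4) ≤ 19 / 40 := by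
      rw [one_div_mul_eq_div, div_le_iff₀ (by positivity)]
      nlinarith
    have h6 : 1 / v * v = 1 := by field_simp
    linarith

end Levels

section LevelMoments

variable {ι : Type*} [Fintype ι] [DecidableEq ι] {A : Finset ι} {p : ι → ℝ} {q : ℝ} {M : ℕ}

theorem one_le_mul_bernoulliExpect_levelCount (hp : ∀ i, p i ∈ Set.Icc (0 : ℝ) 1)
    (hq : q ∈ Set.Icc (0 : ℝ) 1) (hA : ∀ e ∈ A, p e = q) (hM : (#A : ℝ) * q = M) :
    1 ≤ 23 * bernoulliExpect p (fun ω => if M ≤ levelCount A ω then 1 else 0) ∧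
      1 ≤ 23 * bernoulliExpect p (fun ω => if levelCount A ω ≤ M then 1 else 0) := by
  have h1 := bernoulliExpect_sum_coordCentred hA
  have h2 := bernoulliExpect_sum_coordCentred_sq hA
  have h4 := bernoulliExpect_sum_coordCentred_pow_four_le hp hq hA
  simp only [sum_coordCentred_eq hA, hM] at h1 h2 h4
  have hv : (#A : ℝ) * (q * (1 - q)) = 0 ∨ 1 / 2 ≤ (#A : ℝ) * (q * (1 - q)) := by
    rcases Nat.eq_zero_or_pos M with hM0 | hM0
    · left
      rw [← mul_assoc, hM, hM0]
      simp
    have hMA : M ≤ #A := by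
      have : (M : ℝ) ≤ #A := by
        rw [← hM]
        exact mul_le_of_le_one_right (by positivity) hq.2
      exact_mod_cast this
    have hA0 : (0 : ℝ) < #A := by exact_mod_cast hM0.trans_le hMA
    rcases hMA.eq_or_lt with hMA | hMA
    · left
      have : q = 1 := by
        rw [hMA] at hM
        exact mul_left_cancel₀ hA0.ne' (by linarith)
      simp [this]
    · right
      have ha : (1 : ℝ) ≤ M := by exact_mod_cast hM0
      have hb : (M : ℝ) + 1 ≤ #A := by exact_mod_cast hMA
      have : (#A : ℝ) * ((#A : ℝ) * (q * (1 - q))) = M * (#A - M) := by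
        rw [← hM]
        ring
      refine le_of_mul_le_mul_left ?_ hA0
      nlinarith
  have hsep : ∀ c : ℕ, (c : ℝ) < M → 1 ≤ ((c : ℝ) - M) ^ 2 := by
    intro c hc
    have : (c : ℝ) + 1 ≤ M := by exact_mod_cast hc
    nlinarith
  have hsep' : ∀ c : ℕ, (M : ℝ) < c → 1 ≤ ((M : ℝ) - c) ^ 2 := by
    intro c hc
    have : (M : ℝ) + 1 ≤ c := by exact_mod_cast hc
    nlinarith
  constructor
  · have h := one_le_mul_bernoulliExpect_nonneg hp h1 h2 h4 hv
      (fun ω hω => hsep _ (by linarith))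
    simpa using h
  · have h := one_le_mul_bernoulliExpect_nonneg (S := fun ω => (M : ℝ) - levelCount A ω) hp
      (by
        rw [← neg_eq_zero, ← neg_one_mul, ← bernoulliExpect_const_mul, ← h1]
        congr 1
        ext ω
        ring)
      (by
        rw [← h2]
        congr 1
        ext ω
        ring)
      (by
        refine le_trans (le_of_eq ?_) h4
        congr 1
        ext ω
        ring) hv (fun ω hω => hsep' _ (by linarith))
    simpa using h

theorem sum_level_le_of_forall (hp : ∀ i, p i ∈ Set.Icc (0 : ℝ) 1)
    (hq : q ∈ Set.Icc (0 : ℝ) 1) (hA : ∀ e ∈ A, p e = q) (hA' : ∀ e ∉ A, p e = 1 / 2)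
    {Q : ℕ → Prop}
    (hQ : 1 ≤ 23 * bernoulliExpect p (fun ω => if Q (levelCount A ω) then 1 else 0))
    {F : (ι → Bool) → ℝ} (hF : ∀ ω, 0 ≤ F ω)
    (h : ∀ m, Q m → #(level A m) * ∑ ω ∈ level A M, F ω ≤
      #(level A M) * ∑ ω ∈ level A m, F ω) :
    ∑ ω ∈ level A M, F ω ≤ 23 * (#(level A M) * bernoulliExpect p F) := by
  have h1 := sum_level_mul_bernoulliExpect_le hq hA hA' M Q F h
  have h2 : bernoulliExpect p (fun ω => if Q (levelCount A ω) then F ω else 0) ≤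
      bernoulliExpect p F := bernoulliExpect_mono hp fun ω => by
    split_ifs
    · exact le_rfl
    · exact hF ω
  have h3 := mul_le_mul_of_nonneg_left h2 (Nat.cast_nonneg (α := ℝ) #(level A M))
  have h4 := mul_le_mul_of_nonneg_left hQ (Finset.sum_nonneg fun ω (_ : ω ∈ level A M) => hF ω)
  linarith

/-- Moments of an increasing function on a level are controlled by its moments under the
corresponding product measure. -/
theorem sum_level_pow_le (hp : ∀ i, p i ∈ Set.Icc (0 : ℝ) 1)
    (hq : q ∈ Set.Icc (0 : ℝ) 1) (hA : ∀ e ∈ A, p e = q) (hA' : ∀ e ∉ A, p e = 1 / 2)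
    (hM : (#A : ℝ) * q = M) {T : (ι → Bool) → ℝ} (hT : Monotone T) (μ : ℝ) {m : ℕ}
    (hm : m ≠ 0) :
    ∑ ω ∈ level A M, (T ω - μ) ^ (2 * m) ≤
      23 * (#(level A M) * bernoulliExpect p (fun ω => (T ω - μ) ^ (2 * m))) := by
  obtain ⟨hge, hle⟩ := one_le_mul_bernoulliExpect_levelCount hp hq hA hM
  have hsplit : ∀ ω, (T ω - μ) ^ (2 * m) =
      max (T ω - μ) 0 ^ (2 * m) + max (μ - T ω) 0 ^ (2 * m) := by
    intro ω
    have hm' : 2 * m ≠ 0 := by omega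
    rcases le_total 0 (T ω - μ) with h | h
    · rw [max_eq_left h, max_eq_right (by linarith), zero_pow hm', add_zero]
    · rw [max_eq_right h, max_eq_left (by linarith), zero_pow hm', zero_add,
        ← (even_two_mul m).neg_pow, neg_sub]
  have h1 : ∑ ω ∈ level A M, max (T ω - μ) 0 ^ (2 * m) ≤
      23 * (#(level A M) * bernoulliExpect p (fun ω => max (T ω - μ) 0 ^ (2 * m))) := by
    refine sum_level_le_of_forall (Q := fun k => M ≤ k) hp hq hA hA' (by convert hge) (fun ω => by positivity) fun k hk => ?_
    refine card_mul_sum_level_le A hk fun ω ω' h => ?_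
    have := hT h
    gcongr
  have h2 : ∑ ω ∈ level A M, max (μ - T ω) 0 ^ (2 * m) ≤
      23 * (#(level A M) * bernoulliExpect p (fun ω => max (μ - T ω) 0 ^ (2 * m))) := by
    refine sum_level_le_of_forall (Q := fun k => k ≤ M) hp hq hA hA' (by convert hle) (fun ω => by positivity) fun k hk => ?_
    have := card_mul_sum_level_le A hk (F := fun ω => -max (μ - T ω) 0 ^ (2 * m))
      fun ω ω' h => by
        have := hT h
        simp only
        gcongr
    simp only [Finset.sum_neg_distrib, mul_neg, neg_le_neg_iff] at this
    exact this
  simp only [hsplit, Finset.sum_add_distrib, bernoulliExpect_add]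
  linarith

end LevelMoments

section GnM

variable {n M : ℕ}

/-- The potential edges of a graph on `n` vertices. -/
def edgeSlots (n : ℕ) : Finset (Sym2 (Fin n)) := {e | ¬e.IsDiag}

/-- The edge configuration of a Boolean function on unordered pairs. -/
def edgeConfig (η : Sym2 (Fin n) → Bool) (i j : Fin n) : ℝ := coordInd s(i, j) η

theorem edgeConfig_eq_one_iff (η : Sym2 (Fin n) → Bool) (i j : Fin n) :
    edgeConfig η i j = 1 ↔ η s(i, j) = true := by
  simp [edgeConfig, coordInd]

theorem edgeConfig_injective : Function.Injective (edgeConfig (n := n)) := by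
  intro η η' h
  ext e
  induction e with
  | _ i j => rw [Bool.eq_iff_iff, ← edgeConfig_eq_one_iff, h, edgeConfig_eq_one_iff]

theorem card_edges_eq_levelCount (η : Sym2 (Fin n) → Bool) :
    #{u : Fin n × Fin n | u.1 < u.2 ∧ η s(u.1, u.2) = true} = levelCount (edgeSlots n) η := by
  refine Finset.card_nbij (fun u => s(u.1, u.2)) ?_ ?_ ?_
  · intro u hu
    simp only [coe_filter, mem_univ, true_and, Set.mem_ofPred_eq] at hu
    simp [edgeSlots, hu.1.ne, hu.2]
  · intro u hu v hv h
    simp only [coe_filter, mem_univ, true_and, Set.mem_ofPred_eq] at hu hv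
    rcases Sym2.eq_iff.1 h with h | h
    · exact Prod.ext h.1 h.2
    · have h1 := hu.1
      rw [h.1, h.2] at h1
      exact absurd h1 hv.1.not_gt
  · intro e he
    simp only [edgeSlots, coe_filter, mem_filter, mem_univ, true_and, Set.mem_ofPred_eq] at he
    induction e with
    | _ i j =>
      rw [Sym2.mk_isDiag_iff] at he
      rcases lt_or_gt_of_ne he.1 with h | h
      · exact ⟨(i, j), by simp [h, he.2], rfl⟩
      · exact ⟨(j, i), by simp [h, Sym2.eq_swap (a := j), he.2], Sym2.eq_swap⟩

theorem card_edgeSlots (n : ℕ) : #(edgeSlots n) = n.choose 2 := by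
  have h := Sym2.card_subtype_not_diag (α := Fin n)
  rw [Fintype.card_subtype, Fintype.card_fin] at h
  rw [← h, edgeSlots]

theorem erdosRenyiGnM_eq_image :
    erdosRenyiGnM n M = (level (edgeSlots n) M).image edgeConfig := by
  ext ω
  simp only [erdosRenyiGnM, mem_filter, Fintype.mem_piFinset, mem_insert, mem_singleton,
    mem_image, mem_level]
  constructor
  · rintro ⟨h01, hsymm, hcard⟩
    set η : Sym2 (Fin n) → Bool :=
      Sym2.lift ⟨fun i j => decide (ω i j = 1), fun i j => by
        beta_reduce
        rw [hsymm i j]⟩ with hη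
    have hηω : ∀ i j, η s(i, j) = true ↔ ω i j = 1 := fun i j => by simp [hη]
    refine ⟨η, ?_, ?_⟩
    · rw [← card_edges_eq_levelCount, ← hcard]
      simp only [hηω]
    · ext i j
      by_cases h : ω i j = 1
      · rw [h, edgeConfig_eq_one_iff, hηω, h]
      · rw [(h01 i j).resolve_right h, edgeConfig, coordInd, if_neg (by rwa [hηω])]
  · rintro ⟨η, hη, rfl⟩
    refine ⟨fun i j => ?_, fun i j => by rw [edgeConfig, Sym2.eq_swap, edgeConfig], ?_⟩
    · rw [edgeConfig, coordInd]
      split_ifs <;> simp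
    · simp only [edgeConfig_eq_one_iff]
      rw [card_edges_eq_levelCount, hη]

theorem card_erdosRenyiGnM : #(erdosRenyiGnM n M) = #(level (edgeSlots n) M) := by
  rw [erdosRenyiGnM_eq_image, Finset.card_image_of_injective _ edgeConfig_injective]

theorem sum_erdosRenyiGnM (F : (Fin n → Fin n → ℝ) → ℝ) :
    ∑ ω ∈ erdosRenyiGnM n M, F ω = ∑ η ∈ level (edgeSlots n) M, F (edgeConfig η) := by
  rw [erdosRenyiGnM_eq_image, Finset.sum_image edgeConfig_injective.injOn]

theorem triangleCount_edgeConfig (η : Sym2 (Fin n) → Bool) :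
    triangleCount n (edgeConfig η) = triangleSum η := by
  simp only [triangleCount, triangleSum, Finset.sum_filter, Fintype.sum_prod_type, edgeConfig]

theorem coordInd_nonneg {ι : Type*} (i : ι) (ω : ι → Bool) : 0 ≤ coordInd i ω := by
  unfold coordInd
  split_ifs <;> norm_num

theorem coordInd_mono {ι : Type*} (i : ι) : Monotone (coordInd i) := by
  intro ω ω' h
  unfold coordInd
  have := h i
  split_ifs with h1 h2
  · exact le_rfl
  · rw [h1] at this
    exact absurd (this rfl) h2
  · exact zero_le_one
  · exact le_rfl

theorem triangleSum_mono : Monotone (triangleSum (n := n)) := by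
  intro ω ω' h
  refine Finset.sum_le_sum fun i _ => Finset.sum_le_sum fun j _ =>
    Finset.sum_le_sum fun k _ => ?_
  split_ifs
  · have h0 := fun e => coordInd_nonneg e ω
    have h0' := fun e => coordInd_nonneg e ω'
    have h1 := fun e : Sym2 (Fin n) => coordInd_mono e h
    exact mul_le_mul (mul_le_mul (h1 _) (h1 _) (h0 _) (h0' _)) (h1 _) (h0 _)
      (mul_nonneg (h0' _) (h0' _))
  · exact le_rfl

theorem uexpect_sub_pow_le {α : Type*} (Ω : Finset α) (f : α → ℝ) (μ : ℝ) (m : ℕ) :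
    uexpect Ω (fun ω => (f ω - uexpect Ω f) ^ (2 * m)) ≤
      2 * 4 ^ m * uexpect Ω (fun ω => (f ω - μ) ^ (2 * m)) := by
  rcases Ω.eq_empty_or_nonempty with rfl | hΩ
  · simp [uexpect]
  have hc : (0 : ℝ) < #Ω := by exact_mod_cast hΩ.card_pos
  set a := uexpect Ω f with ha
  have hJ : (a - μ) ^ (2 * m) ≤ uexpect Ω (fun ω => (f ω - μ) ^ (2 * m)) := by
    have h := Real.pow_arith_mean_le_arith_mean_pow_of_even Ω (fun _ => (#Ω : ℝ)⁻¹)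
      (fun ω => f ω - μ) (fun _ _ => by positivity)
      (by rw [Finset.sum_const, nsmul_eq_mul, mul_inv_cancel₀ hc.ne']) (even_two_mul m)
    rw [← Finset.mul_sum, ← Finset.mul_sum, Finset.sum_sub_distrib, Finset.sum_const,
      nsmul_eq_mul] at h
    rw [ha, uexpect, uexpect, div_eq_inv_mul, div_eq_inv_mul]
    refine le_trans (le_of_eq ?_) h
    congr 1
    field_simp
  have hpt : ∀ ω, (f ω - a) ^ (2 * m) ≤
      4 ^ m * ((f ω - μ) ^ (2 * m) + (a - μ) ^ (2 * m)) := by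
    intro ω
    rw [pow_mul, pow_mul, pow_mul]
    have h : (f ω - a) ^ 2 ≤ 2 * ((f ω - μ) ^ 2 + (a - μ) ^ 2) := by
      nlinarith [sq_nonneg (f ω - μ + (a - μ))]
    calc _ ≤ (2 * ((f ω - μ) ^ 2 + (a - μ) ^ 2)) ^ m := pow_le_pow_left₀ (sq_nonneg _) h m
      _ = 2 ^ m * ((f ω - μ) ^ 2 + (a - μ) ^ 2) ^ m := mul_pow _ _ _
      _ ≤ 2 ^ m * (2 ^ m * (((f ω - μ) ^ 2) ^ m + ((a - μ) ^ 2) ^ m)) := by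
          gcongr
          exact add_pow_le_two_pow_mul (sq_nonneg _) (sq_nonneg _) m
      _ = _ := by
          rw [← mul_assoc, ← mul_pow]
          norm_num
  have hsum : uexpect Ω (fun ω => (f ω - a) ^ (2 * m)) ≤
      4 ^ m * (uexpect Ω (fun ω => (f ω - μ) ^ (2 * m)) + (a - μ) ^ (2 * m)) := by
    have h := Finset.sum_le_sum fun ω (_ : ω ∈ Ω) => hpt ω
    rw [← Finset.mul_sum, Finset.sum_add_distrib, Finset.sum_const, nsmul_eq_mul] at h
    rw [uexpect, uexpect, div_le_iff₀ hc]
    refine h.trans (le_of_eq ?_)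
    field_simp
  have h4 : (0 : ℝ) < 4 ^ m := by positivity
  have := mul_le_mul_of_nonneg_left hJ h4.le
  linarith

theorem uprob_mul_pow_le {α : Type*} (Ω : Finset α) (f : α → ℝ) {t : ℝ} (ht : 0 ≤ t) (m : ℕ) :
    uprob Ω (fun ω => |f ω| ≥ t) * t ^ (2 * m) ≤ uexpect Ω (fun ω => f ω ^ (2 * m)) := by
  rw [uprob, uexpect, div_mul_eq_mul_div]
  refine div_le_div_of_nonneg_right ?_ (Nat.cast_nonneg _)
  rw [← nsmul_eq_mul, ← Finset.sum_const]
  refine (Finset.sum_le_sum fun ω hω => ?_).trans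
    (Finset.sum_le_sum_of_subset_of_nonneg (Finset.filter_subset _ Ω)
      fun ω _ _ => (even_two_mul m).pow_nonneg (f ω))
  rw [← (even_two_mul m).pow_abs (f ω)]
  exact pow_le_pow_left₀ ht (Finset.mem_filter.1 hω).2 _

theorem uprob_le_one {α : Type*} (Ω : Finset α) (P : α → Prop) : uprob Ω P ≤ 1 := by
  refine div_le_one_of_le₀ ?_ (Nat.cast_nonneg _)
  exact_mod_cast Finset.card_filter_le _ _

/-- Moments of the number of triangles in the uniform random graph. -/
theorem uexpect_triangleCount_pow_le (hn : 2 ≤ n) (hM : M ≤ n.choose 2) {m : ℕ} (hm : m ≠ 0) :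
    uexpect (erdosRenyiGnM n M) (fun ω =>
        (triangleCount n ω - uexpect (erdosRenyiGnM n M) (triangleCount n)) ^ (2 * m)) ≤
      (527444213760 * momentScale n (M / n.choose 2) m) ^ m := by
  set q : ℝ := M / n.choose 2 with hq
  have hN : (0 : ℝ) < n.choose 2 := by exact_mod_cast Nat.choose_pos hn
  have hq01 : q ∈ Set.Icc (0 : ℝ) 1 :=
    ⟨by positivity, (div_le_one hN).2 (by exact_mod_cast hM)⟩
  have hV0 := momentScale_nonneg n q m
  obtain ⟨μ, hμ⟩ := exists_bernoulliExpect_triangleSum_pow_le (n := n) hq01 (by omega) hm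
  have h1 := uexpect_sub_pow_le (erdosRenyiGnM n M) (triangleCount n) μ m
  have h2 : uexpect (erdosRenyiGnM n M) (fun ω => (triangleCount n ω - μ) ^ (2 * m)) ≤
      23 * (2866544640 * momentScale n q m) ^ m := by
    have h := sum_level_pow_le (A := edgeSlots n) (p := edgeProb q) (M := M)
      (edgeProb_mem hq01) hq01
      (fun e he => by rw [edgeProb, if_neg (Finset.mem_filter.1 he).2])
      (fun e he => by
        have : e.IsDiag := by simpa [edgeSlots] using he
        rw [edgeProb, if_pos this])
      (by rw [card_edgeSlots, hq, mul_div_cancel₀ _ hN.ne']) triangleSum_mono μ hm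
    rw [uexpect, sum_erdosRenyiGnM, card_erdosRenyiGnM]
    simp only [triangleCount_edgeConfig]
    refine div_le_of_le_mul₀ (Nat.cast_nonneg _) (by positivity) (h.trans ?_)
    rw [mul_comm (#(level (edgeSlots n) M) : ℝ), ← mul_assoc]
    gcongr
  calc _ ≤ 2 * 4 ^ m * (23 * (2866544640 * momentScale n q m) ^ m) :=
        h1.trans (mul_le_mul_of_nonneg_left h2 (by positivity))
    _ = 46 * (11466178560 * momentScale n q m) ^ m := by
        rw [show 11466178560 * momentScale n q m = 4 * (2866544640 * momentScale n q m) by ring,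
          mul_pow 4]
        ring
    _ ≤ (46 * (11466178560 * momentScale n q m)) ^ m :=
        mul_pow_le_mul_pow (by norm_num) (by positivity) hm
    _ = _ := by ring

/-- The moment scale is at most a multiple of the squared deviation. -/
theorem momentScale_le {q t x θ : ℝ} {m : ℕ} (hq : 0 ≤ q) (ht : 0 ≤ t) (hx : 0 ≤ x)
    (hθ : 0 ≤ θ) (hθ1 : θ ≤ 1) (hm : m ≤ θ * x) (hn : 1 ≤ n)
    (h1 : x ≤ t ^ 2 / ((n : ℝ) ^ 3 + q ^ 2 * (n : ℝ) ^ 3 + q ^ 4 * (n : ℝ) ^ 4))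
    (h2 : x ≤ t / (√n + q * n)) (h3 : x ≤ t ^ ((2 : ℝ) / 3)) :
    momentScale n q m ≤ 3 * θ * t ^ 2 := by
  have hn0 : (0 : ℝ) < n := by exact_mod_cast hn
  have hs : 0 < √(n : ℝ) := Real.sqrt_pos.2 hn0
  have hs2 : √(n : ℝ) ^ 2 = n := Real.sq_sqrt hn0.le
  rw [le_div_iff₀ (by positivity)] at h1 h2
  have h3' : x ^ 3 ≤ t ^ 2 := by
    refine (pow_le_pow_left₀ hx h3 3).trans (le_of_eq ?_)
    rw [← Real.rpow_natCast, ← Real.rpow_mul ht, ← Real.rpow_natCast]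
    norm_num
  have h2' : x ^ 2 * (n + q ^ 2 * n ^ 2) ≤ t ^ 2 := by
    refine le_trans ?_ (pow_le_pow_left₀ (by positivity) h2 2)
    rw [mul_pow]
    gcongr
    have : 0 ≤ √(n : ℝ) * (q * n) := by positivity
    nlinarith
  have h1' : x * ((n : ℝ) ^ 3 + q ^ 4 * n ^ 4) ≤ t ^ 2 := by
    have : 0 ≤ x * (q ^ 2 * (n : ℝ) ^ 3) := by positivity
    linarith
  have e1 : (m : ℝ) * (n ^ 3 + q ^ 4 * n ^ 4) ≤ θ * t ^ 2 := by
    calc _ ≤ θ * x * ((n : ℝ) ^ 3 + q ^ 4 * n ^ 4) := by gcongr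
      _ = θ * (x * ((n : ℝ) ^ 3 + q ^ 4 * n ^ 4)) := by ring
      _ ≤ _ := by gcongr
  have e2 : (m : ℝ) ^ 2 * (n + q ^ 2 * n ^ 2) ≤ θ * t ^ 2 := by
    calc _ ≤ (θ * x) ^ 2 * (n + q ^ 2 * n ^ 2) := by gcongr
      _ = θ ^ 2 * (x ^ 2 * (n + q ^ 2 * n ^ 2)) := by ring
      _ ≤ θ * t ^ 2 := by
        gcongr
        exact pow_le_of_le_one hθ hθ1 two_ne_zero
  have e3 : (m : ℝ) ^ 3 ≤ θ * t ^ 2 := by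
    calc _ ≤ (θ * x) ^ 3 := by gcongr
      _ = θ ^ 3 * x ^ 3 := by ring
      _ ≤ θ * t ^ 2 := by
        gcongr
        exact pow_le_of_le_one hθ hθ1 three_ne_zero
  rw [momentScale]
  linarith

end GnM

/-- Concentration of the triangle count in the `G(n,M)` Erdős–Rényi model. -/
theorem stmt3 :
    ∃ c : ℝ, 0 < c ∧
      ∀ (n M : ℕ) (hn : 3 ≤ n) (hM : M ≤ n.choose 2) (t : ℝ) (ht : 0 ≤ t),
        uprob (erdosRenyiGnM n M)
            (fun ω => |triangleCount n ω - uexpect (erdosRenyiGnM n M) (triangleCount n)| ≥ t) ≤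
          2 * Real.exp (-c * min
            (t ^ 2 / ((n : ℝ) ^ 3 + ((M : ℝ) / (n.choose 2 : ℝ)) ^ 2 * (n : ℝ) ^ 3 +
              ((M : ℝ) / (n.choose 2 : ℝ)) ^ 4 * (n : ℝ) ^ 4))
            (min (t / (Real.sqrt n + ((M : ℝ) / (n.choose 2 : ℝ)) * n))
              (t ^ ((2 : ℝ) / 3)))) := by
  set K : ℝ := 527444213760 with hK
  set θ : ℝ := 1 / (9 * K) with hθ
  have hθ0 : 0 < θ := by rw [hθ, hK]; norm_num
  have hθ1 : θ ≤ 1 := by rw [hθ, hK]; norm_num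
  clear_value θ
  refine ⟨θ / 2, by positivity, fun n M hn hM t ht => ?_⟩
  set q : ℝ := (M : ℝ) / (n.choose 2 : ℝ) with hq
  have hq0 : 0 ≤ q := by positivity
  set x := min (t ^ 2 / ((n : ℝ) ^ 3 + q ^ 2 * (n : ℝ) ^ 3 + q ^ 4 * (n : ℝ) ^ 4))
    (min (t / (Real.sqrt n + q * n)) (t ^ ((2 : ℝ) / 3))) with hx
  have hx0 : 0 ≤ x := by positivity
  rcases lt_or_ge (θ * x) 1 with hlt | hge
  · have h := Real.add_one_le_exp (-(θ / 2) * x)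
    exact (uprob_le_one _ _).trans (by linarith)
  have htpos : 0 < t := by
    refine ht.lt_of_ne fun h => ?_
    have : x ≤ 0 := by
      refine (min_le_left _ _).trans ?_
      rw [← h]
      simp
    nlinarith
  set m := ⌊θ * x⌋₊ with hm
  have hm1 : 1 ≤ m := Nat.le_floor (by simpa using hge)
  have hmle : (m : ℝ) ≤ θ * x := Nat.floor_le (by positivity)
  have hmlt : θ * x < m + 1 := Nat.lt_floor_add_one _
  have hm1' : (1 : ℝ) ≤ m := by exact_mod_cast hm1
  have hV := momentScale_le hq0 ht hx0 hθ0.le hθ1 hmle (by omega : 1 ≤ n) (min_le_left _ _)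
    ((min_le_right _ _).trans (min_le_left _ _)) ((min_le_right _ _).trans (min_le_right _ _))
  have h1 := uprob_mul_pow_le (erdosRenyiGnM n M)
    (fun ω => triangleCount n ω - uexpect (erdosRenyiGnM n M) (triangleCount n)) ht m
  have h2 := uexpect_triangleCount_pow_le (by omega : 2 ≤ n) hM (by omega : m ≠ 0)
  have h3 : K * momentScale n q m ≤ Real.exp (-1) * t ^ 2 := by
    have he : (1 : ℝ) / 3 ≤ Real.exp (-1) := by
      rw [Real.exp_neg, one_div]
      exact inv_anti₀ (Real.exp_pos 1) (by linarith [Real.exp_one_lt_d9])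
    calc K * momentScale n q m ≤ K * (3 * θ * t ^ 2) := by gcongr
      _ = 1 / 3 * t ^ 2 := by rw [hθ]; field_simp; norm_num
      _ ≤ _ := by gcongr
  have h4 := h1.trans (h2.trans (pow_le_pow_left₀
    (mul_nonneg (by norm_num) (momentScale_nonneg n q m)) h3 m))
  rw [mul_pow, ← pow_mul] at h4
  have h5 := le_of_mul_le_mul_right h4 (by positivity)
  refine h5.trans ?_
  rw [← Real.exp_nat_mul]
  have h6 : Real.exp (m * -1) ≤ Real.exp (-(θ / 2) * x) := Real.exp_le_exp.2 (by linarith)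
  linarith [Real.exp_pos (-(θ / 2) * x)]
end
end

section
/- Let f : Ω_{κ,n} → ℝ be an arbitrary function and let c_1,…,c_n ≥ 0 satisfy |f(ω) − f(ω_{i^c}, ω_i')| ≤ c_i for all ω ∈ Ω_{κ,n}, all i, and all admissible ω_i' ∈ 𝒳. Then for every t ≥ 0, P_{κ,n}( (1/n!) Σ_{σ ∈ S_n} f(σω) − E_{κ,n} f ≥ t ) ≤ exp(− t² / (4 (1 − n/N) Σ_{i=1}^n c_i²)), where σω denotes the action of the permutation σ ∈ S_n on ω by permuting its coordinates. -/
open Finset Real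
open scoped Classical

noncomputable section

/-- `Ω_{κ,n}`: the image of the multislice under the projection onto the first `n`
coordinates (`n` out of `N` sampling without replacement). -/
def msProj (L N n : ℕ) (κ : Fin L → ℕ) (x : Fin L → ℝ) (hn : n ≤ N) :
    Finset (Fin n → ℝ) :=
  (multislice L N κ x).image (fun ω => fun i : Fin n => ω (Fin.castLE hn i))

/-- Expectation `E_{κ,n}` with respect to `P_{κ,n}`, the push-forward of the uniform
distribution `P_κ` on the multislice under the projection onto the first `n` coordinates. -/
def msExpectN (L N n : ℕ) (κ : Fin L → ℕ) (x : Fin L → ℝ) (hn : n ≤ N)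
    (f : (Fin n → ℝ) → ℝ) : ℝ :=
  uexpect (multislice L N κ x) (fun ω => f (fun i : Fin n => ω (Fin.castLE hn i)))

/-- Probability `P_{κ,n}` of an event, i.e. the push-forward of the uniform distribution
`P_κ` on the multislice under the projection onto the first `n` coordinates. -/
def msProbN (L N n : ℕ) (κ : Fin L → ℕ) (x : Fin L → ℝ) (hn : n ≤ N)
    (p : (Fin n → ℝ) → Prop) : ℝ :=
  uprob (multislice L N κ x) (fun ω => p (fun i : Fin n => ω (Fin.castLE hn i)))

/-- A symmetric form of Hoeffding's lemma for the uniform distribution on a finite type. -/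
lemma sum_exp_sub_mean_le {ι : Type*} [Fintype ι] [Nonempty ι] (X : ι → ℝ) (r : ℝ)
    (hX : ∀ p q, |X p - X q| ≤ r) (l : ℝ) :
    ∑ p, Real.exp (l * (X p - (∑ q, X q) / Fintype.card ι)) ≤
      Fintype.card ι * Real.exp (l ^ 2 * r ^ 2 / 2) := by
  have hcard : (0 : ℝ) < Fintype.card ι := by exact_mod_cast Fintype.card_pos
  set A := (∑ q, X q) / Fintype.card ι with hA
  have hsum : ∑ p, (X p - A) = 0 := by
    rw [Finset.sum_sub_distrib, Finset.sum_const, Finset.card_univ, nsmul_eq_mul, hA]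
    field_simp
    ring
  have hbound : ∀ p, |X p - A| ≤ r := by
    intro p
    have h1 : X p - A = (∑ q, (X p - X q)) / Fintype.card ι := by
      rw [Finset.sum_sub_distrib, Finset.sum_const, Finset.card_univ, nsmul_eq_mul, hA]
      field_simp
    rw [h1, abs_div, abs_of_pos hcard, div_le_iff₀ hcard]
    calc |∑ q, (X p - X q)| ≤ ∑ q, |X p - X q| := Finset.abs_sum_le_sum_abs _ _
      _ ≤ ∑ _q : ι, r := Finset.sum_le_sum fun q _ => hX p q
      _ = r * Fintype.card ι := by simp [mul_comm]
  rcases eq_or_ne r 0 with rfl | hr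
  · have : ∀ p, X p - A = 0 := fun p => abs_nonpos_iff.mp (hbound p)
    simp [this]
  · have hr0 : 0 < r := lt_of_le_of_ne ((abs_nonneg _).trans (hbound (Classical.arbitrary ι))) hr.symm
    have h1 : ∀ p, Real.exp (l * (X p - A)) ≤
        Real.cosh (l * r) + (X p - A) * (Real.sinh (l * r) / r) := by
      intro p
      have ht : |(X p - A) / r| ≤ 1 := by
        rw [abs_div, abs_of_pos hr0, div_le_one hr0]
        exact hbound p
      have := Real.exp_mul_le_cosh_add_mul_sinh ht (l * r)
      have e1 : (X p - A) / r * (l * r) = l * (X p - A) := by field_simp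
      rw [e1] at this
      refine this.trans (le_of_eq ?_)
      ring
    calc ∑ p, Real.exp (l * (X p - A))
        ≤ ∑ p, (Real.cosh (l * r) + (X p - A) * (Real.sinh (l * r) / r)) :=
          Finset.sum_le_sum fun p _ => h1 p
      _ = Fintype.card ι * Real.cosh (l * r) := by
          rw [Finset.sum_add_distrib, ← Finset.sum_mul, hsum]
          simp
      _ ≤ _ := by
          gcongr
          refine (Real.cosh_le_exp_half_sq _).trans (le_of_eq ?_)
          congr 1
          ring

lemma decomposeFin_symm_mul_swap {N : ℕ} (p : Fin (N + 1)) (e : Equiv.Perm (Fin N))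
    (i j : Fin N) :
    Equiv.Perm.decomposeFin.symm (p, e * Equiv.swap i j) =
      Equiv.Perm.decomposeFin.symm (p, e) * Equiv.swap i.succ j.succ := by
  ext k
  refine Fin.cases ?_ (fun k => ?_) k
  · rw [Equiv.Perm.mul_apply, Equiv.swap_apply_of_ne_of_ne (Fin.succ_ne_zero i).symm
      (Fin.succ_ne_zero j).symm]
    simp
  · rw [Equiv.Perm.mul_apply, ← (Fin.succ_injective N).map_swap]
    simp

lemma sum_decomposeFin {N : ℕ} (F : Equiv.Perm (Fin (N + 1)) → ℝ) :
    ∑ τ, F τ = ∑ p, ∑ e, F (Equiv.Perm.decomposeFin.symm (p, e)) := by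
  rw [← Fintype.sum_prod_type', ← Equiv.sum_comp Equiv.Perm.decomposeFin.symm]

lemma sum_decomposeFin_fiber {N : ℕ} (F : Equiv.Perm (Fin (N + 1)) → ℝ) (p : Fin (N + 1)) :
    ∑ e, F (Equiv.Perm.decomposeFin.symm (p, e)) = ∑ τ with τ 0 = p, F τ := by
  rw [Finset.sum_filter, sum_decomposeFin, Finset.sum_eq_single p]
  · simp
  · intro q _ hq
    simp [hq]
  · simp

/-- The number of permutations sending `0 ↦ p` and `j ↦ q` is `N! / N`. -/
lemma card_perm_two_values {N : ℕ} (p q : Fin (N + 1)) (hpq : p ≠ q) (j : Fin (N + 1))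
    (hj : j ≠ 0) :
    N * #{τ : Equiv.Perm (Fin (N + 1)) | τ 0 = p ∧ τ j = q} = N.factorial := by
  have hconst : ∀ k : Fin (N + 1), k ≠ 0 →
      #{τ : Equiv.Perm (Fin (N + 1)) | τ 0 = p ∧ τ k = q} =
        #{τ : Equiv.Perm (Fin (N + 1)) | τ 0 = p ∧ τ j = q} := by
    intro k hk
    refine Finset.card_equiv (Equiv.mulRight (Equiv.swap k j)) fun τ => ?_
    simp [Equiv.swap_apply_of_ne_of_ne hk.symm hj.symm]
  have htot : #{τ : Equiv.Perm (Fin (N + 1)) | τ 0 = p} = N.factorial := by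
    have h := sum_decomposeFin_fiber (fun _ => (1 : ℝ)) p
    simp only [Finset.sum_const, Finset.card_univ, Fintype.card_perm, Fintype.card_fin,
      nsmul_eq_mul, mul_one] at h
    exact_mod_cast h.symm
  have hsplit : #{τ : Equiv.Perm (Fin (N + 1)) | τ 0 = p} =
      ∑ k ∈ Finset.univ.erase (0 : Fin (N + 1)),
        #{τ : Equiv.Perm (Fin (N + 1)) | τ 0 = p ∧ τ k = q} := by
    rw [Finset.card_eq_sum_card_fiberwise (f := fun τ : Equiv.Perm (Fin (N + 1)) => τ.symm q)
      (t := Finset.univ.erase 0)]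
    · refine Finset.sum_congr rfl fun k _ => ?_
      congr 1
      ext τ
      simp only [Finset.mem_filter, Finset.mem_univ, true_and, Equiv.symm_apply_eq,
        eq_comm (a := q)]
    · intro τ hτ
      have h0 : τ 0 = p := by simpa using hτ
      simp only [Finset.coe_erase, Finset.coe_univ, Set.mem_sdiff, Set.mem_univ, true_and,
        Set.mem_singleton_iff, Equiv.symm_apply_eq]
      rw [h0]
      exact hpq.symm
  rw [← htot, hsplit, Finset.sum_congr rfl fun k hk => hconst k (Finset.ne_of_mem_erase hk)]
  simp

/-- Conditioning on the value at `0` moves the mean of a function of the first `n + 1` values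
by at most `c (N - n) / N`. -/
lemma abs_sum_fiber_sub_le {N n : ℕ} (hn : n ≤ N) (c : ℝ)
    (G : Equiv.Perm (Fin (N + 1)) → ℝ)
    (hin : ∀ τ i j, i.val < n + 1 → j.val < n + 1 → G (τ * Equiv.swap i j) = G τ)
    (hmix : ∀ τ i j, i.val < n + 1 → n + 1 ≤ j.val → |G τ - G (τ * Equiv.swap i j)| ≤ c)
    (p q : Fin (N + 1)) (hpq : p ≠ q) :
    |(∑ e, G (Equiv.Perm.decomposeFin.symm (p, e))) -
      ∑ e, G (Equiv.Perm.decomposeFin.symm (q, e))| ≤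
        c * ((N : ℝ) - n) / N * N.factorial := by
  have hq : ∑ τ with τ 0 = q, G τ =
      ∑ τ : Equiv.Perm (Fin (N + 1)) with τ 0 = p, G (Equiv.swap p q * τ) := by
    symm
    refine Finset.sum_equiv (Equiv.mulLeft (Equiv.swap p q)) (fun τ => ?_) (fun τ _ => rfl)
    simp [Equiv.swap_apply_eq_iff]
  have hN : (N : ℝ) ≠ 0 := by
    rintro h
    have : N = 0 := by exact_mod_cast h
    subst this
    exact hpq (Fin.ext (by omega))
  rw [sum_decomposeFin_fiber, sum_decomposeFin_fiber, hq, ← Finset.sum_sub_distrib]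
  have hterm : ∀ τ : Equiv.Perm (Fin (N + 1)), τ 0 = p →
      |G τ - G (Equiv.swap p q * τ)| ≤
        ∑ j : Fin (N + 1) with n + 1 ≤ j.val, if τ j = q then c else 0 := by
    intro τ hτ
    have hswap : Equiv.swap p q * τ = τ * Equiv.swap 0 (τ.symm q) := by
      rw [Equiv.mul_swap_eq_swap_mul, hτ, Equiv.apply_symm_apply]
    have hsum : (∑ j : Fin (N + 1) with n + 1 ≤ j.val, if τ j = q then c else 0) =
        if n + 1 ≤ (τ.symm q).val then c else 0 := by
      simp only [← Equiv.eq_symm_apply, Finset.sum_ite_eq', Finset.mem_filter, Finset.mem_univ,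
        true_and]
    rw [hswap, hsum]
    split_ifs with h
    · exact hmix τ _ _ (by simp) h
    · rw [hin τ _ _ (by simp) (by omega)]
      simp
  have hcount : ∀ j : Fin (N + 1), n + 1 ≤ j.val →
      (∑ τ : Equiv.Perm (Fin (N + 1)) with τ 0 = p, if τ j = q then c else 0) =
        c / N * N.factorial := by
    intro j hj
    have h := card_perm_two_values p q hpq j (by rintro rfl; simp at hj)
    rw [← Finset.sum_filter, Finset.filter_filter, Finset.sum_const, nsmul_eq_mul, ← h]
    push_cast
    field_simp
  have hcard : ((#{j : Fin (N + 1) | n + 1 ≤ j.val} : ℕ) : ℝ) = (N : ℝ) - n := by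
    have h1 : #{j : Fin (N + 1) | n + 1 ≤ j.val} + #{j : Fin (N + 1) | ¬ n + 1 ≤ j.val} = N + 1 := by
      rw [Finset.card_filter_add_card_filter_not]
      simp
    have h2 : #{j : Fin (N + 1) | ¬ n + 1 ≤ j.val} = n + 1 := by
      simp only [not_le]
      rw [Fin.card_filter_val_lt]
      omega
    have h3 : ((#{j : Fin (N + 1) | n + 1 ≤ j.val} : ℕ) : ℝ) + (n + 1) = N + 1 := by
      exact_mod_cast h2 ▸ h1
    linarith
  calc _ ≤ ∑ τ : Equiv.Perm (Fin (N + 1)) with τ 0 = p, |G τ - G (Equiv.swap p q * τ)| :=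
        Finset.abs_sum_le_sum_abs _ _
    _ ≤ ∑ τ : Equiv.Perm (Fin (N + 1)) with τ 0 = p,
          ∑ j : Fin (N + 1) with n + 1 ≤ j.val, if τ j = q then c else 0 :=
        Finset.sum_le_sum fun τ hτ => hterm τ (by simpa using hτ)
    _ = ∑ j : Fin (N + 1) with n + 1 ≤ j.val, c / N * N.factorial := by
        rw [Finset.sum_comm]
        exact Finset.sum_congr rfl fun j hj => hcount j (by simpa using hj)
    _ = _ := by
        rw [Finset.sum_const, nsmul_eq_mul, hcard]
        ring

/-- Exponential moment bound for a function of a random permutation that depends only on the set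
of its first `n` values, and changes by at most `c` when one of these values is exchanged. -/
lemma sum_perm_exp_le (c : ℝ) (hc : 0 ≤ c) (l : ℝ) (N : ℕ) :
    ∀ n ≤ N, ∀ G : Equiv.Perm (Fin N) → ℝ,
      (∀ τ i j, i.val < n → j.val < n → G (τ * Equiv.swap i j) = G τ) →
      (∀ τ i j, n ≤ i.val → n ≤ j.val → G (τ * Equiv.swap i j) = G τ) →
      (∀ τ i j, i.val < n → n ≤ j.val → |G τ - G (τ * Equiv.swap i j)| ≤ c) →
      ∑ τ, Real.exp (l * (G τ - (∑ ρ, G ρ) / N.factorial)) ≤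
        N.factorial * Real.exp (l ^ 2 * (c ^ 2 * (n * (N - n) / N))) := by
  induction N with
  | zero =>
    intro n hn G _ _ _
    simp
  | succ N ih =>
    intro n hn G hin hout hmix
    rcases n with _ | n
    · have hconst : ∀ τ, G τ = G 1 := by
        intro τ
        induction τ using Equiv.Perm.swap_induction_on' with
        | one => rfl
        | mul_swap f x y _ hf => rw [hout _ _ _ (Nat.zero_le _) (Nat.zero_le _), hf]
      have hfac : ((N + 1).factorial : ℝ) ≠ 0 := by positivity
      have hmean : (∑ ρ, G ρ) / (N + 1).factorial = G 1 := by
        rw [Finset.sum_congr rfl fun ρ _ => hconst ρ, Finset.sum_const, Finset.card_univ,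
          Fintype.card_perm, Fintype.card_fin, nsmul_eq_mul]
        field_simp
      rw [hmean]
      simp [hconst, Fintype.card_perm]
    · have hnN : n ≤ N := by omega
      have hnN' : (n : ℝ) ≤ N := by exact_mod_cast hnN
      have hfac : (0 : ℝ) < N.factorial := by positivity
      set H : Fin (N + 1) → Equiv.Perm (Fin N) → ℝ :=
        fun p e => G (Equiv.Perm.decomposeFin.symm (p, e)) with hH
      set X : Fin (N + 1) → ℝ := fun p => (∑ e, H p e) / N.factorial with hXdef
      have hmean : (∑ ρ, G ρ) / (N + 1).factorial = (∑ p, X p) / Fintype.card (Fin (N + 1)) := by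
        rw [sum_decomposeFin, hXdef, ← Finset.sum_div, Fintype.card_fin, div_div,
          Nat.factorial_succ]
        push_cast
        rw [mul_comm ((N : ℝ) + 1)]
      have hX : ∀ p q, |X p - X q| ≤ c * ((N : ℝ) - n) / N := by
        intro p q
        rcases eq_or_ne p q with rfl | hpq
        · rw [sub_self, abs_zero]
          have : 0 ≤ (N : ℝ) - n := by linarith
          positivity
        · have h := abs_sum_fiber_sub_le hnN c G hin hmix p q hpq
          rw [hXdef]
          simp only
          rw [← sub_div, abs_div, abs_of_pos hfac, div_le_iff₀ hfac]
          exact h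
      have hih : ∀ p, ∑ e, Real.exp (l * (H p e - X p)) ≤
          N.factorial * Real.exp (l ^ 2 * (c ^ 2 * (n * (N - n) / N))) := by
        intro p
        refine ih n hnN (H p) ?_ ?_ ?_
        · intro e i j hi hj
          simp only [hH, decomposeFin_symm_mul_swap]
          exact hin _ _ _ (by simpa using hi) (by simpa using hj)
        · intro e i j hi hj
          simp only [hH, decomposeFin_symm_mul_swap]
          exact hout _ _ _ (by simpa using hi) (by simpa using hj)
        · intro e i j hi hj
          simp only [hH, decomposeFin_symm_mul_swap]
          exact hmix _ _ _ (by simpa using hi) (by simpa using hj)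
      have hK : (n : ℝ) * (N - n) / N + (((N : ℝ) - n) / N) ^ 2 / 2 ≤
          (n + 1) * (N - n) / (N + 1) := by
        rcases Nat.eq_zero_or_pos N with rfl | hNpos
        · have : n = 0 := by omega
          subst this
          simp
        · have hN1 : (1 : ℝ) ≤ N := by exact_mod_cast hNpos
          rw [← sub_nonneg]
          have : (n + 1) * (N - n) / (N + 1) -
              ((n : ℝ) * (N - n) / N + (((N : ℝ) - n) / N) ^ 2 / 2) =
              (N - n) ^ 2 * (N - 1) / (2 * N ^ 2 * (N + 1)) := by
            field_simp
            ring
          rw [this]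
          have : (0 : ℝ) ≤ N - 1 := by linarith
          positivity
      rw [hmean, sum_decomposeFin]
      set A := (∑ p, X p) / Fintype.card (Fin (N + 1)) with hA
      calc ∑ p, ∑ e, Real.exp (l * (H p e - A))
          = ∑ p, Real.exp (l * (X p - A)) * ∑ e, Real.exp (l * (H p e - X p)) := by
            refine Finset.sum_congr rfl fun p _ => ?_
            rw [Finset.mul_sum]
            refine Finset.sum_congr rfl fun e _ => ?_
            rw [← Real.exp_add]
            congr 1
            ring
        _ ≤ ∑ p, Real.exp (l * (X p - A)) *
              (N.factorial * Real.exp (l ^ 2 * (c ^ 2 * (n * (N - n) / N)))) :=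
            Finset.sum_le_sum fun p _ => mul_le_mul_of_nonneg_left (hih p) (Real.exp_nonneg _)
        _ ≤ (Fintype.card (Fin (N + 1)) * Real.exp (l ^ 2 * (c * ((N : ℝ) - n) / N) ^ 2 / 2)) *
              (N.factorial * Real.exp (l ^ 2 * (c ^ 2 * (n * (N - n) / N)))) := by
            rw [← Finset.sum_mul]
            exact mul_le_mul_of_nonneg_right (sum_exp_sub_mean_le X _ hX l) (by positivity)
        _ = (N + 1).factorial * Real.exp (l ^ 2 * (c ^ 2 *
              ((n : ℝ) * (N - n) / N + (((N : ℝ) - n) / N) ^ 2 / 2))) := by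
            rw [mul_mul_mul_comm, ← Real.exp_add, Nat.factorial_succ, Fintype.card_fin]
            push_cast
            congr 2
            ring
        _ ≤ _ := by
            push_cast
            have : ((n : ℝ) + 1) * (N + 1 - (n + 1)) / (N + 1) =
                (n + 1) * (N - n) / (N + 1) := by ring
            rw [this]
            gcongr

lemma exists_perm_castLE {n N : ℕ} (hn : n ≤ N) (σ : Equiv.Perm (Fin n)) :
    ∃ ρ : Equiv.Perm (Fin N), ∀ i, ρ (Fin.castLE hn i) = Fin.castLE hn (σ i) :=
  ⟨σ.viaFintypeEmbedding (Fin.castLEEmb hn),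
    fun i => σ.viaFintypeEmbedding_apply_image (Fin.castLEEmb hn) i⟩

lemma comp_mem_multislice {L N : ℕ} {κ : Fin L → ℕ} {x : Fin L → ℝ} {ω : Fin N → ℝ}
    (hω : ω ∈ multislice L N κ x) (τ : Equiv.Perm (Fin N)) : ω ∘ τ ∈ multislice L N κ x := by
  simp only [multislice, Finset.mem_filter, Fintype.mem_piFinset] at hω ⊢
  refine ⟨fun i => hω.1 (τ i), fun ℓ => ?_⟩
  rw [← hω.2 ℓ]
  exact Finset.card_equiv τ fun i => by simp

lemma exists_perm_of_mem_multislice {L N : ℕ} {κ : Fin L → ℕ} {x : Fin L → ℝ}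
    {ω ω' : Fin N → ℝ} (hω : ω ∈ multislice L N κ x) (hω' : ω' ∈ multislice L N κ x) :
    ∃ τ : Equiv.Perm (Fin N), ω' = ω ∘ τ := by
  simp only [multislice, Finset.mem_filter, Fintype.mem_piFinset] at hω hω'
  have hcard : ∀ y : ℝ, Fintype.card {i // ω' i = y} = Fintype.card {i // ω i = y} := by
    intro y
    rw [Fintype.card_subtype, Fintype.card_subtype]
    by_cases hy : y ∈ Finset.image x Finset.univ
    · obtain ⟨ℓ, -, rfl⟩ := Finset.mem_image.mp hy
      rw [hω.2, hω'.2]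
    · rw [Finset.filter_false_of_mem, Finset.filter_false_of_mem]
      · rintro i - rfl
        exact hy (hω.1 i)
      · rintro i - rfl
        exact hy (hω'.1 i)
  refine ⟨Equiv.ofFiberEquiv fun y => Fintype.equivOfCardEq (hcard y), ?_⟩
  funext i
  exact (Equiv.ofFiberEquiv_map _ i).symm

/-- The uniform distribution on the multislice is the law of a uniformly random rearrangement
of any of its points. -/
lemma uexpect_multislice_eq {L N : ℕ} {κ : Fin L → ℕ} {x : Fin L → ℝ} {ω₀ : Fin N → ℝ}
    (hω₀ : ω₀ ∈ multislice L N κ x) (F : (Fin N → ℝ) → ℝ) :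
    uexpect (multislice L N κ x) F =
      (∑ τ : Equiv.Perm (Fin N), F (ω₀ ∘ τ)) / N.factorial := by
  set Ω := multislice L N κ x with hΩ
  have hpos : (0 : ℝ) < #Ω := by exact_mod_cast Finset.card_pos.mpr ⟨ω₀, hω₀⟩
  have hfac : (0 : ℝ) < N.factorial := by positivity
  have h1 : ∑ ω ∈ Ω, ∑ τ : Equiv.Perm (Fin N), F (ω ∘ τ) =
      #Ω * ∑ τ : Equiv.Perm (Fin N), F (ω₀ ∘ τ) := by
    rw [← nsmul_eq_mul, ← Finset.sum_const]
    refine Finset.sum_congr rfl fun ω hω => ?_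
    obtain ⟨ρ, rfl⟩ := exists_perm_of_mem_multislice hω₀ hω
    exact Equiv.sum_comp (Equiv.mulLeft ρ) fun τ : Equiv.Perm (Fin N) => F (ω₀ ∘ τ)
  have h2 : ∑ ω ∈ Ω, ∑ τ : Equiv.Perm (Fin N), F (ω ∘ τ) = N.factorial * ∑ ω ∈ Ω, F ω := by
    rw [Finset.sum_comm]
    have : ∀ τ : Equiv.Perm (Fin N), ∑ ω ∈ Ω, F (ω ∘ τ) = ∑ ω ∈ Ω, F ω := by
      intro τ
      refine Finset.sum_bij' (fun ω _ => ω ∘ τ) (fun ω _ => ω ∘ τ.symm)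
        (fun ω hω => comp_mem_multislice hω τ) (fun ω hω => comp_mem_multislice hω τ.symm)
        ?_ ?_ (fun _ _ => rfl)
      · intro ω _
        funext i
        simp
      · intro ω _
        funext i
        simp
    simp [this, Fintype.card_perm]
  rw [uexpect, div_eq_div_iff hpos.ne' hfac.ne', mul_comm, ← h2, h1, mul_comm]

/-- Chernoff's bound for the uniform distribution on a finite set. -/
lemma uprob_ge_le_uexpect_exp {α : Type*} (Ω : Finset α) (X : α → ℝ) (t l : ℝ) (hl : 0 ≤ l) :
    uprob Ω (fun ω => X ω ≥ t) ≤ uexpect Ω fun ω => Real.exp (l * (X ω - t)) := by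
  rw [uprob, uexpect]
  gcongr
  rw [Finset.card_filter]
  push_cast
  refine Finset.sum_le_sum fun ω _ => ?_
  split_ifs with h
  · exact Real.one_le_exp (mul_nonneg hl (sub_nonneg.mpr h))
  · exact Real.exp_nonneg _

lemma sum_perm_symm_apply {n : ℕ} (c : Fin n → ℝ) (i : Fin n) :
    ∑ σ : Equiv.Perm (Fin n), c (σ.symm i) = n.factorial * ((∑ j, c j) / n) := by
  have hn : (n : ℝ) ≠ 0 := by exact_mod_cast (Fin.pos i).ne'
  have hconst : ∀ j, ∑ σ : Equiv.Perm (Fin n), c (σ.symm j) =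
      ∑ σ : Equiv.Perm (Fin n), c (σ.symm i) := by
    intro j
    rw [← Equiv.sum_comp (Equiv.mulLeft (Equiv.swap i j))]
    refine Finset.sum_congr rfl fun σ _ => congrArg c ?_
    simp [Equiv.symm_apply_eq]
  have htot : ∑ j, ∑ σ : Equiv.Perm (Fin n), c (σ.symm j) = n.factorial * ∑ j, c j := by
    rw [Finset.sum_comm, Finset.sum_congr rfl fun σ _ => Equiv.sum_comp σ.symm c]
    simp [Fintype.card_perm]
  rw [Finset.sum_congr rfl fun j _ => hconst j] at htot
  simp only [Finset.sum_const, Finset.card_univ, Fintype.card_fin, nsmul_eq_mul] at htot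
  rw [← mul_div_assoc, ← htot]
  field_simp

/-- Bounded differences inequality for sampling without replacement, with the
finite-sampling correction factor `1 - n/N`. -/
theorem stmt4 (L N n : ℕ) (hL : 2 ≤ L) (κ : Fin L → ℕ) (hκ : ∀ ℓ, 1 ≤ κ ℓ)
    (hN : N = ∑ ℓ, κ ℓ) (x : Fin L → ℝ) (hx : StrictMono x) (hn : n ≤ N)
    (f : (Fin n → ℝ) → ℝ) (c : Fin n → ℝ) (hc : ∀ i, 0 ≤ c i)
    (hf : ∀ ω ∈ msProj L N n κ x hn, ∀ ω' ∈ msProj L N n κ x hn, ∀ i : Fin n,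
      (∀ j : Fin n, j ≠ i → ω' j = ω j) → |f ω - f ω'| ≤ c i)
    (t : ℝ) (ht : 0 ≤ t) :
    msProbN L N n κ x hn
        (fun ω => (1 / (n.factorial : ℝ)) * ∑ σ : Equiv.Perm (Fin n), f (ω ∘ σ) -
          msExpectN L N n κ x hn f ≥ t) ≤
      Real.exp (-(t ^ 2) / (4 * (1 - (n : ℝ) / N) * ∑ i, c i ^ 2)) := by
  set ι : Fin n → Fin N := Fin.castLE hn with hι
  set Ω := multislice L N κ x with hΩ
  set C : ℝ := ∑ i, c i ^ 2 with hC
  have hCnn : 0 ≤ C := Finset.sum_nonneg fun i _ => sq_nonneg _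
  set g : (Fin n → ℝ) → ℝ := fun ω =>
    (1 / (n.factorial : ℝ)) * ∑ σ : Equiv.Perm (Fin n), f (ω ∘ σ) with hg
  rcases Ω.eq_empty_or_nonempty with hemp | ⟨ω₀, hω₀⟩
  · have : msProbN L N n κ x hn (fun ω => g ω - msExpectN L N n κ x hn f ≥ t) = 0 := by
      simp [msProbN, uprob, ← hΩ, hemp]
    rw [this]
    exact Real.exp_nonneg _
  set G : Equiv.Perm (Fin N) → ℝ := fun τ => g (ω₀ ∘ τ ∘ ι) with hG
  set b : ℝ := (∑ i, c i) / n with hb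
  have hb0 : 0 ≤ b := div_nonneg (Finset.sum_nonneg fun i _ => hc i) (Nat.cast_nonneg _)
  have hgsymm : ∀ ω (σ : Equiv.Perm (Fin n)), g (ω ∘ σ) = g ω := by
    intro ω σ
    simp only [hg]
    congr 1
    exact Equiv.sum_comp (Equiv.mulLeft σ) fun ρ : Equiv.Perm (Fin n) => f (ω ∘ ρ)
  have hmem : ∀ (τ : Equiv.Perm (Fin N)) (σ : Equiv.Perm (Fin n)),
      (ω₀ ∘ τ ∘ ι) ∘ σ ∈ msProj L N n κ x hn := by
    intro τ σ
    obtain ⟨ρ, hρ⟩ := exists_perm_castLE hn σ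
    refine Finset.mem_image.mpr ⟨ω₀ ∘ (τ * ρ : Equiv.Perm (Fin N)), comp_mem_multislice hω₀ _, ?_⟩
    funext i
    simp [hρ, hι]
  have hin : ∀ τ i j, i.val < n → j.val < n → G (τ * Equiv.swap i j) = G τ := by
    intro τ i j hi hj
    rw [hG]
    simp only
    rw [← hgsymm (ω₀ ∘ τ ∘ ι) (Equiv.swap ⟨i, hi⟩ ⟨j, hj⟩)]
    congr 1
    funext k
    have h := (Fin.castLE_injective hn).map_swap ⟨i, hi⟩ ⟨j, hj⟩ k
    simp only [Function.comp_apply, Equiv.Perm.mul_apply, hι, h]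
    rfl
  have hout : ∀ τ i j, n ≤ i.val → n ≤ j.val → G (τ * Equiv.swap i j) = G τ := by
    intro τ i j hi hj
    simp only [hG]
    congr 1
    funext k
    have hk : (ι k).val < n := k.isLt
    simp only [Function.comp_apply, Equiv.Perm.mul_apply]
    rw [Equiv.swap_apply_of_ne_of_ne]
    · rintro rfl
      omega
    · rintro rfl
      omega
  have hmix : ∀ τ i j, i.val < n → n ≤ j.val → |G τ - G (τ * Equiv.swap i j)| ≤ b := by
    intro τ i j hi hj
    have hfac : (0 : ℝ) < n.factorial := by positivity
    have hσ : ∀ σ : Equiv.Perm (Fin n), |f ((ω₀ ∘ τ ∘ ι) ∘ σ) -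
        f ((ω₀ ∘ (τ * Equiv.swap i j : Equiv.Perm (Fin N)) ∘ ι) ∘ σ)| ≤ c (σ.symm ⟨i, hi⟩) := by
      intro σ
      refine hf _ (hmem _ _) _ (hmem _ _) _ fun k hk => ?_
      have hki : ι (σ k) ≠ i := by
        intro h
        apply hk
        rw [Equiv.eq_symm_apply]
        exact Fin.castLE_injective hn h
      have hkj : ι (σ k) ≠ j := by
        intro h
        have : (ι (σ k)).val < n := (σ k).isLt
        rw [h] at this
        omega
      simp [Equiv.swap_apply_of_ne_of_ne hki hkj]
    simp only [hG, hg]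
    rw [← mul_sub, ← Finset.sum_sub_distrib, abs_mul, abs_of_pos (by positivity), one_div,
      inv_mul_le_iff₀ hfac]
    calc _ ≤ ∑ σ : Equiv.Perm (Fin n), c (σ.symm ⟨i, hi⟩) :=
          (Finset.abs_sum_le_sum_abs _ _).trans (Finset.sum_le_sum fun σ _ => hσ σ)
      _ = _ := sum_perm_symm_apply c _
  have hmean : msExpectN L N n κ x hn f = (∑ τ, G τ) / N.factorial := by
    have h1 : ∀ σ : Equiv.Perm (Fin n),
        ∑ τ : Equiv.Perm (Fin N), f ((ω₀ ∘ τ ∘ ι) ∘ σ) =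
          ∑ τ : Equiv.Perm (Fin N), f (ω₀ ∘ τ ∘ ι) := by
      intro σ
      obtain ⟨ρ, hρ⟩ := exists_perm_castLE hn σ
      symm
      rw [← Equiv.sum_comp (Equiv.mulRight ρ)]
      refine Finset.sum_congr rfl fun τ _ => congrArg f ?_
      funext i
      simp [hρ, hι]
    rw [msExpectN, uexpect_multislice_eq hω₀]
    congr 1
    simp only [hG, hg]
    rw [← Finset.mul_sum, Finset.sum_comm, Finset.sum_congr rfl fun σ _ => h1 σ,
      Finset.sum_const, Finset.card_univ, Fintype.card_perm, Fintype.card_fin, nsmul_eq_mul]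
    have hfac : (n.factorial : ℝ) ≠ 0 := by positivity
    field_simp
    rfl
  set A := msExpectN L N n κ x hn f with hA
  set D : ℝ := (1 - (n : ℝ) / N) * C with hD
  have hnN : (n : ℝ) ≤ N := by exact_mod_cast hn
  have hfrac : 0 ≤ 1 - (n : ℝ) / N :=
    sub_nonneg.mpr (div_le_one_of_le₀ hnN (Nat.cast_nonneg _))
  have hbD : b ^ 2 * (n * (N - n) / N) ≤ D := by
    rcases Nat.eq_zero_or_pos n with h0 | hpos
    · have : (n : ℝ) = 0 := by exact_mod_cast h0
      rw [this]
      simpa using mul_nonneg hfrac hCnn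
    · have hn0 : (0 : ℝ) < n := by exact_mod_cast hpos
      have hN0 : (0 : ℝ) < N := hn0.trans_le hnN
      have hcs : (∑ i, c i) ^ 2 ≤ n * C := by
        simpa using sq_sum_le_card_mul_sum_sq (s := Finset.univ) (f := c)
      have h1 : b ^ 2 * (n * (N - n) / N) = (1 - (n : ℝ) / N) * ((∑ i, c i) ^ 2 / n) := by
        rw [hb]
        field_simp
      rw [h1]
      refine mul_le_mul_of_nonneg_left ?_ hfrac
      rw [div_le_iff₀ hn0, mul_comm]
      exact hcs
  have hmgf : ∀ l : ℝ, 0 ≤ l →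
      msProbN L N n κ x hn (fun ω => g ω - A ≥ t) ≤ Real.exp (l ^ 2 * D - l * t) := by
    intro l hl
    have hfac : (0 : ℝ) < N.factorial := by positivity
    have h := sum_perm_exp_le b hb0 l N n hn G hin hout hmix
    rw [← hmean] at h
    refine (uprob_ge_le_uexpect_exp Ω (fun ω => g (fun i => ω (ι i)) - A) t l hl).trans ?_
    rw [uexpect_multislice_eq hω₀, div_le_iff₀ hfac]
    calc ∑ τ : Equiv.Perm (Fin N), Real.exp (l * (g (fun i => (ω₀ ∘ τ) (ι i)) - A - t))
        = (∑ τ, Real.exp (l * (G τ - A))) * Real.exp (-(l * t)) := by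
          rw [Finset.sum_mul]
          refine Finset.sum_congr rfl fun τ _ => ?_
          rw [← Real.exp_add]
          congr 1
          simp only [hG, Function.comp_def]
          ring
      _ ≤ (N.factorial * Real.exp (l ^ 2 * (b ^ 2 * (n * (N - n) / N)))) *
            Real.exp (-(l * t)) := by gcongr
      _ ≤ (N.factorial * Real.exp (l ^ 2 * D)) * Real.exp (-(l * t)) := by gcongr
      _ = _ := by
          rw [sub_eq_add_neg, Real.exp_add]
          ring
  have hD0 : 0 ≤ D := mul_nonneg hfrac hCnn
  rw [mul_assoc 4, ← hD]
  rcases hD0.eq_or_lt with h0 | hpos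
  · have := hmgf 0 le_rfl
    simpa [← h0, hg] using this
  · refine (hmgf (t / (2 * D)) (by positivity)).trans (le_of_eq ?_)
    congr 1
    field_simp
    ring
end
end
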